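/- arXiv:1408.6359 — 3 statements merged into one kernel-verified Lean document; each statement's English description precedes it below -/
import Mathlib

section
/- Let 𝒜 be of nonstandard p(·)-growth with constants a₋, b⁺ and let ℬ be an admissible right-hand side. Suppose there exist δ > 0, γ < 0, and an increasing sequence of radii R_k → ∞ such that ess inf_{B_{2R_k}∖B_{R_k}} p ≥ n + δ + 1 − γ for every k. Let u > 0 be a bounded (𝒜,ℬ)-harmonic function in ℝⁿ such that x ↦ ℬ(x,u(x),∇u(x)) u(x)^{γ} belongs to L¹(ℝⁿ) and lim_{R→∞} ∫_{B_R} ℬ(x,u(x),∇u(x)) u(x)^{γ} dx = 0. Then u is constant. -/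
open MeasureTheory Metric Real
open scoped ContDiff

noncomputable section

abbrev Euc (n : ℕ) := EuclideanSpace ℝ (Fin n)

/-- Measure of the unit ball in `ℝⁿ`. -/
def omegaEuc (n : ℕ) : ℝ := (volume (Metric.ball (0 : Euc n) 1)).toReal

/-- A measurable variable exponent `p` with `p⁻ = pm` and `p⁺ = pP`,
`1 < p⁻` and `p⁺ < ∞` (encoded by the a.e. bounds). -/
structure IsVarExp {n : ℕ} (p : Euc n → ℝ) (pm pP : ℝ) : Prop where
  meas : Measurable p
  one_lt : 1 < pm
  inf_eq : essInf p (volume : Measure (Euc n)) = pm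
  sup_eq : essSup p (volume : Measure (Euc n)) = pP
  ae_lb : ∀ᵐ x ∂(volume : Measure (Euc n)), pm ≤ p x
  ae_ub : ∀ᵐ x ∂(volume : Measure (Euc n)), p x ≤ pP

/-- `𝒜` is of nonstandard `p(·)`-growth with constants `am = a₋`, `bP = b⁺`. -/
structure IsNSGrowth {n : ℕ} (p : Euc n → ℝ) (𝒜 : Euc n → ℝ → Euc n → Euc n)
    (am bP : ℝ) : Prop where
  am_pos : 0 < am
  meas : ∀ (t : ℝ) (ξ : Euc n), Measurable (fun x => 𝒜 x t ξ)
  cont : ∀ x : Euc n, Continuous (fun tξ : ℝ × Euc n => 𝒜 x tξ.1 tξ.2)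
  growth : ∃ a b : Euc n → ℝ, Measurable a ∧ Measurable b ∧
      (∀ x, am ≤ a x ∧ a x ≤ b x ∧ b x ≤ bP) ∧
      (∀ x t ξ, a x * ‖ξ‖ ^ p x ≤ (inner ℝ (𝒜 x t ξ) ξ : ℝ)) ∧
      (∀ x t ξ, ‖𝒜 x t ξ‖ ≤ b x * ‖ξ‖ ^ (p x - 1))

/-- `u` is `𝒜`-harmonic in `ℝⁿ` (C¹ functions replace `W^{1,p(·)}_loc`). -/
def IsAHarmonic {n : ℕ} (p : Euc n → ℝ) (𝒜 : Euc n → ℝ → Euc n → Euc n)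
    (u : Euc n → ℝ) : Prop :=
  ContDiff ℝ 1 u ∧
  LocallyIntegrable (fun x => ‖gradient u x‖ ^ p x) (volume : Measure (Euc n)) ∧
  ∀ φ : Euc n → ℝ, ContDiff ℝ ∞ φ → HasCompactSupport φ →
    ∫ x, (inner ℝ (𝒜 x (u x) (gradient u x)) (gradient φ x) : ℝ) = 0

/-- `u` is an `𝒜`-subsolution in `ℝⁿ`. -/
def IsASubsolution {n : ℕ} (p : Euc n → ℝ) (𝒜 : Euc n → ℝ → Euc n → Euc n)
    (u : Euc n → ℝ) : Prop :=
  ContDiff ℝ 1 u ∧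
  LocallyIntegrable (fun x => ‖gradient u x‖ ^ p x) (volume : Measure (Euc n)) ∧
  ∀ φ : Euc n → ℝ, ContDiff ℝ ∞ φ → HasCompactSupport φ → (∀ x, 0 ≤ φ x) →
    ∫ x, (inner ℝ (𝒜 x (u x) (gradient u x)) (gradient φ x) : ℝ) ≤ 0

/-- `ℬ` is an admissible right-hand side. -/
structure IsAdmissibleRHS {n : ℕ} (p : Euc n → ℝ) (ℬ : Euc n → ℝ → Euc n → ℝ) : Prop where
  meas : ∀ (t : ℝ) (ξ : Euc n), Measurable (fun x => ℬ x t ξ)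
  cont : ∀ x : Euc n, Continuous (fun tξ : ℝ × Euc n => ℬ x tξ.1 tξ.2)
  bound : ∃ c : Euc n → ℝ, Measurable c ∧ (∃ cP : ℝ, ∀ x, c x ≤ cP) ∧
      ∀ x t ξ, |ℬ x t ξ| ≤ c x * (1 + ‖ξ‖ ^ (p x - 1))

/-- `u` is `(𝒜,ℬ)`-harmonic in `ℝⁿ`. -/
def IsABHarmonic {n : ℕ} (p : Euc n → ℝ) (𝒜 : Euc n → ℝ → Euc n → Euc n)
    (ℬ : Euc n → ℝ → Euc n → ℝ) (u : Euc n → ℝ) : Prop :=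
  ContDiff ℝ 1 u ∧
  LocallyIntegrable (fun x => ‖gradient u x‖ ^ p x) (volume : Measure (Euc n)) ∧
  ∀ φ : Euc n → ℝ, ContDiff ℝ ∞ φ → HasCompactSupport φ →
    ∫ x, (inner ℝ (𝒜 x (u x) (gradient u x)) (gradient φ x) : ℝ)
      = ∫ x, ℬ x (u x) (gradient u x) * φ x

/-- `u` is a supersolution of `div 𝒜(x,u,∇u) = f(u)` in `ℝⁿ`. -/
def IsFSupersolution {n : ℕ} (p : Euc n → ℝ) (𝒜 : Euc n → ℝ → Euc n → Euc n)
    (f : ℝ → ℝ) (u : Euc n → ℝ) : Prop :=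
  ContDiff ℝ 1 u ∧
  LocallyIntegrable (fun x => ‖gradient u x‖ ^ p x) (volume : Measure (Euc n)) ∧
  ∀ φ : Euc n → ℝ, ContDiff ℝ ∞ φ → HasCompactSupport φ → (∀ x, 0 ≤ φ x) →
    ∫ x, f (u x) * φ x ≤ - ∫ x, (inner ℝ (𝒜 x (u x) (gradient u x)) (gradient φ x) : ℝ)


section Mollification

variable {E F : Type*} [NormedAddCommGroup E] [NormedSpace ℝ E] [FiniteDimensional ℝ E]
  [MeasurableSpace E] [BorelSpace E] {μ : Measure E} [μ.IsAddHaarMeasure]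
  [NormedAddCommGroup F] [NormedSpace ℝ F] [CompleteSpace F]

/-- Mollifying at scale at most one a bounded continuous function supported in `K` yields a
function that is bounded and supported in the unit thickening of `K`. -/
lemma norm_normed_convolution_le_indicator (ρ : ContDiffBump (0 : E)) (hρ : ρ.rOut ≤ 1)
    {g : E → F} (hg : Continuous g) {K : Set E} (hK : ∀ x, x ∉ K → g x = 0) {C : ℝ}
    (hC : ∀ x, ‖g x‖ ≤ C) (x : E) :
    ‖convolution (ρ.normed μ) g (ContinuousLinearMap.lsmul ℝ ℝ) μ x‖ ≤
      (cthickening 1 K).indicator (fun _ => 3 * C) x := by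
  by_cases hx : x ∈ cthickening 1 K
  · rw [Set.indicator_of_mem hx]
    have h := ρ.dist_normed_convolution_le (μ := μ) (g := g) (x₀ := x) (ε := C + C)
      hg.aestronglyMeasurable (fun y _ => by
        rw [dist_eq_norm]
        exact (norm_sub_le _ _).trans (add_le_add (hC y) (hC x)))
    have h' := norm_le_norm_add_norm_sub'
      (convolution (ρ.normed μ) g (ContinuousLinearMap.lsmul ℝ ℝ) μ x) (g x)
    rw [dist_eq_norm] at h
    linarith [hC x]
  · have hzero : ∀ y ∈ ball x ρ.rOut, g y = 0 := fun y hy => hK y fun hyK =>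
      hx (mem_cthickening_of_dist_le x y 1 K hyK
        (((dist_comm x y).trans_lt (mem_ball.1 hy)).le.trans hρ))
    have hgx := hzero x (mem_ball_self ρ.rOut_pos)
    have h := ρ.dist_normed_convolution_le (μ := μ) (g := g) (x₀ := x) (ε := 0)
      hg.aestronglyMeasurable (fun y hy => by rw [hzero y hy, hgx, dist_self])
    rw [hgx, dist_zero_right] at h
    rwa [Set.indicator_of_notMem hx]

/-- A compactly supported `C¹` function is the limit, together with its derivative, of smooth
functions whose values and derivatives are dominated by a bounded function of compact support. -/
lemma exists_smooth_approx {g : E → ℝ} (hg : ContDiff ℝ 1 g) (hgc : HasCompactSupport g) :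
    ∃ (G : ℕ → E → ℝ) (K : Set E) (C : ℝ), IsCompact K ∧
      (∀ j, ContDiff ℝ ∞ (G j)) ∧ (∀ j, HasCompactSupport (G j)) ∧
      (∀ j x, ‖G j x‖ ≤ K.indicator (fun _ => C) x) ∧
      (∀ j x, ‖fderiv ℝ (G j) x‖ ≤ K.indicator (fun _ => C) x) ∧
      (∀ x, Filter.Tendsto (fun j => G j x) Filter.atTop (nhds (g x))) ∧
      (∀ x, Filter.Tendsto (fun j => fderiv ℝ (G j) x) Filter.atTop (nhds (fderiv ℝ g x))) := by
  let μ : Measure E := Measure.addHaar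
  have hg' : Continuous (fderiv ℝ g) := hg.continuous_fderiv one_ne_zero
  obtain ⟨C₁, hC₁⟩ := hg.continuous.bounded_above_of_compact_support hgc
  obtain ⟨C₂, hC₂⟩ := hg'.bounded_above_of_compact_support (hgc.fderiv ℝ)
  let ρ : ℕ → ContDiffBump (0 : E) := fun j =>
    ⟨1 / ((j : ℝ) + 1) / 2, 1 / ((j : ℝ) + 1), by positivity, half_lt_self (by positivity)⟩
  have hρ1 : ∀ j, (ρ j).rOut ≤ 1 := fun j => by
    change 1 / ((j : ℝ) + 1) ≤ 1
    rw [div_le_one (by positivity)]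
    linarith [(Nat.cast_nonneg j : (0 : ℝ) ≤ j)]
  have hρ0 : Filter.Tendsto (fun j => (ρ j).rOut) Filter.atTop (nhds 0) :=
    tendsto_one_div_add_atTop_nhds_zero_nat
  have hderiv : ∀ j x, fderiv ℝ
      (convolution ((ρ j).normed μ) g (ContinuousLinearMap.lsmul ℝ ℝ) μ) x =
      convolution ((ρ j).normed μ) (fderiv ℝ g) (ContinuousLinearMap.lsmul ℝ ℝ) μ x := by
    intro j x
    rw [(hgc.hasFDerivAt_convolution_right (ContinuousLinearMap.lsmul ℝ ℝ)
      (ρ j).continuous_normed.locallyIntegrable hg x).fderiv]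
    rfl
  refine ⟨fun j => convolution ((ρ j).normed μ) g (ContinuousLinearMap.lsmul ℝ ℝ) μ,
    cthickening 1 (tsupport g), 3 * max C₁ C₂, hgc.isCompact.cthickening, fun j => ?_,
    fun j => ?_, fun j x => ?_, fun j x => ?_, fun x => ?_, fun x => ?_⟩
  · exact (ρ j).hasCompactSupport_normed.contDiff_convolution_left _ (n := ⊤)
      (ρ j).contDiff_normed hg.continuous.locallyIntegrable
  · exact HasCompactSupport.convolution _ (ρ j).hasCompactSupport_normed hgc
  · exact norm_normed_convolution_le_indicator (ρ j) (hρ1 j) hg.continuous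
      (fun y hy => image_eq_zero_of_notMem_tsupport hy)
      (fun y => (hC₁ y).trans (le_max_left _ _)) x
  · rw [hderiv]
    exact norm_normed_convolution_le_indicator (ρ j) (hρ1 j) hg'
      (fun y hy => image_eq_zero_of_notMem_tsupport
        fun h => hy (tsupport_fderiv_subset ℝ h))
      (fun y => (hC₂ y).trans (le_max_right _ _)) x
  · exact ContDiffBump.convolution_tendsto_right_of_continuous hρ0 hg.continuous x
  · simp_rw [hderiv]
    exact ContDiffBump.convolution_tendsto_right_of_continuous hρ0 hg' x

end Mollification

lemma norm_gradient_eq {n : ℕ} (f : Euc n → ℝ) (x : Euc n) :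
    ‖gradient f x‖ = ‖fderiv ℝ f x‖ :=
  LinearIsometryEquiv.norm_map _ _

lemma continuous_gradient {n : ℕ} {f : Euc n → ℝ} (hf : ContDiff ℝ 1 f) :
    Continuous (gradient f) :=
  (LinearIsometryEquiv.continuous _).comp (hf.continuous_fderiv one_ne_zero)

/-- A weak formulation tested on smooth functions extends to `C¹` test functions. -/
lemma weak_formulation_of_contDiff_one {n : ℕ} {V : Euc n → Euc n} {f : Euc n → ℝ}
    (hV : LocallyIntegrable V volume) (hf : LocallyIntegrable f volume)
    (hweak : ∀ φ : Euc n → ℝ, ContDiff ℝ ∞ φ → HasCompactSupport φ →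
      ∫ x, (inner ℝ (V x) (gradient φ x) : ℝ) = ∫ x, f x * φ x)
    {φ : Euc n → ℝ} (hφ : ContDiff ℝ 1 φ) (hφc : HasCompactSupport φ) :
    ∫ x, (inner ℝ (V x) (gradient φ x) : ℝ) = ∫ x, f x * φ x := by
  obtain ⟨G, K, C, hK, hG, hGc, hGb, hGb', hlim, hlim'⟩ := exists_smooth_approx hφ hφc
  have hG1 : ∀ j, ContDiff ℝ 1 (G j) := fun j => (hG j).of_le (by exact_mod_cast le_top)
  have hleft : Filter.Tendsto (fun j => ∫ x, (inner ℝ (V x) (gradient (G j) x) : ℝ))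
      Filter.atTop (nhds (∫ x, (inner ℝ (V x) (gradient φ x) : ℝ))) := by
    refine tendsto_integral_of_dominated_convergence (K.indicator fun x => ‖V x‖ * C)
      (fun j => hV.aestronglyMeasurable.inner
        (continuous_gradient (hG1 j)).aestronglyMeasurable) ?_ (fun j => .of_forall fun x => ?_)
      (.of_forall fun x => ?_)
    · exact (integrable_indicator_iff hK.measurableSet).2
        ((hV.integrableOn_isCompact hK).norm.mul_const C)
    · refine (norm_inner_le_norm _ _).trans ?_
      rw [norm_gradient_eq]
      refine (mul_le_mul_of_nonneg_left (hGb' j x) (norm_nonneg _)).trans_eq ?_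
      by_cases hx : x ∈ K <;> simp [hx]
    · exact tendsto_const_nhds.inner
        (((LinearIsometryEquiv.continuous _).tendsto _).comp (hlim' x))
  have hright : Filter.Tendsto (fun j => ∫ x, f x * G j x)
      Filter.atTop (nhds (∫ x, f x * φ x)) := by
    refine tendsto_integral_of_dominated_convergence (K.indicator fun x => ‖f x‖ * C)
      (fun j => hf.aestronglyMeasurable.mul (hG j).continuous.aestronglyMeasurable) ?_
      (fun j => .of_forall fun x => ?_) (.of_forall fun x => ?_)
    · exact (integrable_indicator_iff hK.measurableSet).2
        ((hf.integrableOn_isCompact hK).norm.mul_const C)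
    · rw [norm_mul]
      refine (mul_le_mul_of_nonneg_left (hGb j x) (norm_nonneg _)).trans_eq ?_
      by_cases hx : x ∈ K <;> simp [hx]
    · exact tendsto_const_nhds.mul (hlim x)
  refine tendsto_nhds_unique hleft (hright.congr fun j => ?_)
  exact (hweak (G j) (hG j) (hGc j)).symm

/-- Composing a Carathéodory map with measurable functions is measurable. -/
lemma measurable_caratheodory_comp {n : ℕ} {Y : Type*} [MeasurableSpace Y] [TopologicalSpace Y]
    [TopologicalSpace.PseudoMetrizableSpace Y] [BorelSpace Y] {T : Euc n → ℝ → Euc n → Y}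
    (hmeas : ∀ t ξ, Measurable fun x => T x t ξ)
    (hcont : ∀ x, Continuous fun tξ : ℝ × Euc n => T x tξ.1 tξ.2)
    {v : Euc n → ℝ} {w : Euc n → Euc n} (hv : Measurable v) (hw : Measurable w) :
    Measurable fun x => T x (v x) (w x) :=
  (measurable_uncurry_of_continuous_of_measurable
    (u := fun (tξ : ℝ × Euc n) x => T x tξ.1 tξ.2) hcont fun tξ => hmeas tξ.1 tξ.2).comp
    ((hv.prodMk hw).prodMk measurable_id)

lemma locallyIntegrable_of_norm_le_rpow {n : ℕ} {Y : Type*} [NormedAddCommGroup Y]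
    {p : Euc n → ℝ} {pm pP b : ℝ} (hp : IsVarExp p pm pP) {w : Euc n → Euc n}
    (hw : Continuous w) {V : Euc n → Y} (hV : AEStronglyMeasurable V volume)
    (hVb : ∀ x, ‖V x‖ ≤ b * (1 + ‖w x‖ ^ (p x - 1))) :
    LocallyIntegrable V volume := by
  have hdom : Continuous fun x => |b| * (1 + (1 + ‖w x‖) ^ pP) := by
    refine continuous_const.mul (continuous_const.add
      ((continuous_const.add hw.norm).rpow_const fun x => Or.inl ?_))
    exact (add_pos_of_pos_of_nonneg one_pos (norm_nonneg _)).ne'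
  refine hdom.locallyIntegrable.mono hV ?_
  filter_upwards [hp.ae_lb, hp.ae_ub] with x hx1 hx2
  have hone := hp.one_lt
  have h1 : ‖w x‖ ^ (p x - 1) ≤ (1 + ‖w x‖) ^ pP :=
    (Real.rpow_le_rpow (norm_nonneg _) (by linarith) (by linarith)).trans
      (Real.rpow_le_rpow_of_exponent_le (by linarith [norm_nonneg (w x)]) (by linarith))
  rw [Real.norm_of_nonneg (by positivity)]
  calc ‖V x‖ ≤ b * (1 + ‖w x‖ ^ (p x - 1)) := hVb x
    _ ≤ |b| * (1 + ‖w x‖ ^ (p x - 1)) := by gcongr; exact le_abs_self b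
    _ ≤ _ := by gcongr

/-- `η` is a smooth cutoff between the balls of radii `r` and `2 * r`, with derivative bounded
by `d`. -/
structure IsCutoff {n : ℕ} (η : Euc n → ℝ) (r d : ℝ) : Prop where
  smooth : ContDiff ℝ ∞ η
  compact : HasCompactSupport η
  nonneg : ∀ x, 0 ≤ η x
  le_one : ∀ x, η x ≤ 1
  eq_one : ∀ x ∈ ball 0 r, η x = 1
  fderiv_eq_zero : ∀ x ∈ ball 0 r, fderiv ℝ η x = 0
  eq_zero : ∀ x, x ∉ ball 0 (2 * r) → η x = 0
  fderiv_le : ∀ x, ‖fderiv ℝ η x‖ ≤ d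

/-- Smooth cutoffs between concentric balls of radii `r` and `2 * r`, with derivative `O(1 / r)`. -/
lemma exists_cutoff (n : ℕ) : ∃ C : ℝ, 0 < C ∧ ∀ r : ℝ, 0 < r →
    ∃ η : Euc n → ℝ, IsCutoff η r (C / r) := by
  let ψ : ContDiffBump (0 : Euc n) := ⟨1, 2, one_pos, one_lt_two⟩
  have hψ : ContDiff ℝ ∞ ψ := ψ.contDiff
  obtain ⟨C, hC⟩ := (hψ.continuous_fderiv (by simp)).bounded_above_of_compact_support
    (ψ.hasCompactSupport.fderiv ℝ)
  refine ⟨|C| + 1, by positivity, fun r hr => ?_⟩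
  have hone : ∀ x ∈ ball (0 : Euc n) r, ψ (r⁻¹ • x) = 1 := fun x hx => by
    refine ψ.one_of_mem_closedBall ?_
    rw [mem_closedBall_zero_iff, norm_smul, norm_inv, Real.norm_of_nonneg hr.le,
      inv_mul_le_iff₀ hr]
    simpa [ψ] using (mem_ball_zero_iff.1 hx).le
  refine ⟨fun x => ψ (r⁻¹ • x), hψ.comp (contDiff_const_smul _), ?_, fun x => ψ.nonneg,
    fun x => ψ.le_one, hone, fun x hx => ?_, fun x hx => ?_, fun x => ?_⟩
  · exact ψ.hasCompactSupport.comp_smul (inv_ne_zero hr.ne')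
  · have : (fun x => ψ (r⁻¹ • x)) =ᶠ[nhds x] fun _ => (1 : ℝ) :=
      Filter.eventually_of_mem (isOpen_ball.mem_nhds hx) hone
    rw [this.fderiv_eq]
    simp
  · refine ψ.zero_of_le_dist ?_
    rw [dist_zero_right, norm_smul, norm_inv, Real.norm_of_nonneg hr.le, le_inv_mul_iff₀ hr]
    simpa [ψ, mul_comm] using hx
  · rw [fderiv_comp_smul, norm_smul, norm_inv, Real.norm_of_nonneg hr.le, ← div_eq_inv_mul]
    gcongr
    linarith [hC (r⁻¹ • x), le_abs_self C]

/-- A Young-type inequality with small parameter `ε`, uniform in the exponent `p ∈ [q, P]`. -/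
lemma rpow_mul_le_small_add {u t η D d M ε γ p q P : ℝ} {N : ℕ} (hu : 0 < u) (huM : u ≤ M)
    (hM : 1 ≤ M) (ht : 0 ≤ t) (hη0 : 0 ≤ η) (hη1 : η ≤ 1) (hD0 : 0 ≤ D) (hDd : D ≤ d)
    (hd : d ≤ 1) (hγ : γ < 0) (hq : 1 - γ ≤ q) (hqp : q ≤ p) (hpP : p ≤ P) (hPN : P ≤ N)
    (hε0 : 0 < ε) (hε1 : ε ≤ 1) :
    u ^ γ * η ^ (N - 1) * t ^ (p - 1) * D ≤
      ε * (u ^ (γ - 1) * t ^ p * η ^ N) + ε⁻¹ ^ P * M ^ P * d ^ q := by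
  have hd0 : 0 ≤ d := hD0.trans hDd
  have hM0 : 0 ≤ M := by linarith
  have hp1 : 0 < p - 1 := by linarith
  have hN : N = (N - 1) + 1 := by
    have : (1 : ℝ) < N := by linarith
    have : 1 < N := by exact_mod_cast this
    omega
  have htp : t ^ p = t ^ (p - 1) * t := by
    rw [← Real.rpow_add_one' ht (by linarith)]
    congr 1
    ring
  have hηN : η ^ N = η ^ (N - 1) * η := by rw [← pow_succ, ← hN]
  have huγ : u ^ γ = u ^ (γ - 1) * u := by
    rw [← Real.rpow_add_one hu.ne']
    congr 1
    ring
  rcases le_or_gt (D * u) (ε * (t * η)) with h | h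
  · have hrem : 0 ≤ ε⁻¹ ^ P * M ^ P * d ^ q := by positivity
    calc u ^ γ * η ^ (N - 1) * t ^ (p - 1) * D
        = u ^ (γ - 1) * η ^ (N - 1) * t ^ (p - 1) * (D * u) := by rw [huγ]; ring
      _ ≤ u ^ (γ - 1) * η ^ (N - 1) * t ^ (p - 1) * (ε * (t * η)) := by gcongr
      _ = ε * (u ^ (γ - 1) * t ^ p * η ^ N) := by rw [htp, hηN]; ring
      _ ≤ _ := by linarith
  · have hlead : 0 ≤ ε * (u ^ (γ - 1) * t ^ p * η ^ N) := by positivity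
    have hηp : η ^ (N - 1) ≤ η ^ (p - 1) := by
      rw [← Real.rpow_natCast]
      refine Real.rpow_le_rpow_of_exponent_ge' hη0 hη1 hp1.le ?_
      have : (N : ℝ) = ((N - 1 : ℕ) : ℝ) + 1 := by exact_mod_cast hN
      linarith
    have hX : t * η ≤ ε⁻¹ * (D * u) := by
      rw [le_inv_mul_iff₀ hε0]
      exact h.le
    have hε' : 1 ≤ ε⁻¹ := (one_le_inv₀ hε0).2 hε1
    calc u ^ γ * η ^ (N - 1) * t ^ (p - 1) * D
        ≤ u ^ γ * η ^ (p - 1) * t ^ (p - 1) * D := by gcongr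
      _ = u ^ γ * (t * η) ^ (p - 1) * D := by rw [Real.mul_rpow ht hη0]; ring
      _ ≤ u ^ γ * (ε⁻¹ * (D * u)) ^ (p - 1) * D := by gcongr
      _ = ε⁻¹ ^ (p - 1) * u ^ (γ + (p - 1)) * D ^ p := by
        rw [Real.mul_rpow (by positivity) (by positivity), Real.mul_rpow hD0 hu.le,
          Real.rpow_add hu, show D ^ p = D ^ (p - 1) * D by
            rw [← Real.rpow_add_one' hD0 (by linarith)]
            congr 1
            ring]
        ring
      _ ≤ ε⁻¹ ^ P * M ^ P * d ^ q := by
        have h1 : ε⁻¹ ^ (p - 1) ≤ ε⁻¹ ^ P :=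
          Real.rpow_le_rpow_of_exponent_le hε' (by linarith)
        have h2 : u ^ (γ + (p - 1)) ≤ M ^ P :=
          (Real.rpow_le_rpow hu.le huM (by linarith)).trans
            (Real.rpow_le_rpow_of_exponent_le hM (by linarith))
        have h3 : D ^ p ≤ d ^ q :=
          (Real.rpow_le_rpow hD0 hDd (by linarith)).trans
            (Real.rpow_le_rpow_of_exponent_ge' hd0 hd (by linarith) hqp)
        gcongr
      _ ≤ _ := by linarith

lemma inner_gradient_rpow_mul_pow {n : ℕ} {u η : Euc n → ℝ} {x : Euc n} (γ : ℝ) (N : ℕ)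
    (hu : DifferentiableAt ℝ u x) (hη : DifferentiableAt ℝ η x) (hux : u x ≠ 0) (v : Euc n) :
    inner ℝ v (gradient (fun y => u y ^ γ * η y ^ N) x) =
      γ * (u x ^ (γ - 1) * η x ^ N) * inner ℝ v (gradient u x) +
        N * (u x ^ γ * η x ^ (N - 1)) * fderiv ℝ η x v := by
  rw [real_inner_comm, real_inner_comm (gradient u x), inner_gradient_left, inner_gradient_left,
    ((hu.hasFDerivAt.rpow_const (p := γ) (Or.inl hux)).fun_mul (hη.hasFDerivAt.pow N)).fderiv]
  simp
  ring

/-- Testing the weak equation with `u ^ γ * η ^ N` controls the weighted gradient energy. -/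
lemma energy_estimate {n : ℕ} {p : Euc n → ℝ} {pm pP am bP γ q M : ℝ} (hp : IsVarExp p pm pP)
    (ham : 0 < am) (hb : 0 < bP) (hγ : γ < 0) (hq : 1 - γ ≤ q) {u f : Euc n → ℝ}
    {V : Euc n → Euc n} (hu : ContDiff ℝ 1 u) (hpos : ∀ x, 0 < u x) (huM : ∀ x, u x ≤ M)
    (hloc : LocallyIntegrable (fun x => ‖gradient u x‖ ^ p x) volume)
    (hV : LocallyIntegrable V volume) (hf : LocallyIntegrable f volume)
    (hweak : ∀ φ : Euc n → ℝ, ContDiff ℝ ∞ φ → HasCompactSupport φ →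
      ∫ x, (inner ℝ (V x) (gradient φ x) : ℝ) = ∫ x, f x * φ x)
    (hlow : ∀ x, am * ‖gradient u x‖ ^ p x ≤ (inner ℝ (V x) (gradient u x) : ℝ))
    (hup : ∀ x, ‖V x‖ ≤ bP * ‖gradient u x‖ ^ (p x - 1)) :
    ∃ (N : ℕ) (c K : ℝ), 0 < c ∧ ∀ (η : Euc n → ℝ) (r d : ℝ), IsCutoff η r d → d ≤ 1 →
      (∀ᵐ x, x ∈ ball (0 : Euc n) (2 * r) \ ball 0 r → q ≤ p x) →
      Integrable (fun x => u x ^ (γ - 1) * ‖gradient u x‖ ^ p x * η x ^ N) ∧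
      c * ∫ x, u x ^ (γ - 1) * ‖gradient u x‖ ^ p x * η x ^ N ≤
        K * d ^ q * volume.real (ball (0 : Euc n) (2 * r)) -
          ∫ x, f x * u x ^ γ * η x ^ N := by
  obtain ⟨N, hN⟩ := exists_nat_ge (max pP 2)
  have hNP : pP ≤ N := (le_max_left _ _).trans hN
  have hN2 : 2 ≤ N := by exact_mod_cast (le_max_right _ _).trans hN
  have hN0 : (0 : ℝ) < N := by exact_mod_cast (by omega : 0 < N)
  set ε : ℝ := min 1 (-γ * am / 2 / (N * bP))
  have hc : 0 < -γ * am / 2 := half_pos (mul_pos (neg_pos.2 hγ) ham)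
  have hε0 : 0 < ε := lt_min one_pos (div_pos hc (mul_pos hN0 hb))
  have hε1 : ε ≤ 1 := min_le_left _ _
  have hεc : N * bP * ε ≤ -γ * am / 2 := by
    rw [← le_div_iff₀' (mul_pos hN0 hb)]
    exact min_le_right _ _
  set M' : ℝ := max M 1
  refine ⟨N, -γ * am / 2, N * bP * (ε⁻¹ ^ pP * M' ^ pP), hc,
    fun η r d hη hd hann => ?_⟩
  have hη1 : ContDiff ℝ 1 η := hη.smooth.of_le (by exact_mod_cast le_top)
  have hd0 : 0 ≤ d := (norm_nonneg _).trans (hη.fderiv_le 0)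
  have hM'1 : 1 ≤ M' := le_max_right _ _
  have hηc : HasCompactSupport fun x => η x ^ N :=
    hη.compact.comp_left (g := fun s : ℝ => s ^ N) (zero_pow (by omega))
  have hupow : ∀ s : ℝ, ContDiff ℝ 1 fun x => u x ^ s := fun s =>
    hu.rpow_const_of_ne fun x => (hpos x).ne'
  have hφ : ContDiff ℝ 1 fun x => u x ^ γ * η x ^ N := (hupow γ).mul (hη1.pow N)
  have hφc : HasCompactSupport fun x => u x ^ γ * η x ^ N := hηc.mul_left
  have hint : Integrable fun x => u x ^ (γ - 1) * ‖gradient u x‖ ^ p x * η x ^ N := by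
    have h := hloc.integrable_smul_left_of_hasCompactSupport
      (g := fun x => u x ^ (γ - 1) * η x ^ N)
      ((hupow (γ - 1)).continuous.mul (hη1.continuous.pow N)) hηc.mul_left
    refine h.congr (.of_forall fun x => ?_)
    simp only [smul_eq_mul]
    ring
  refine ⟨hint, ?_⟩
  have htest := weak_formulation_of_contDiff_one hV hf hweak hφ hφc
  have hrhs : ∫ x, f x * u x ^ γ * η x ^ N = ∫ x, f x * (u x ^ γ * η x ^ N) := by
    simp_rw [mul_assoc]
  have hintV : Integrable fun x =>
      (inner ℝ (V x) (gradient (fun y => u y ^ γ * η y ^ N) x) : ℝ) := by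
    have hVn : LocallyIntegrable (fun x => ‖V x‖) volume :=
      hV.mono hV.aestronglyMeasurable.norm (.of_forall fun x => (norm_norm _).le)
    have h := hVn.integrable_smul_left_of_hasCompactSupport
      (hφ.continuous_fderiv one_ne_zero).norm (hφc.fderiv ℝ).norm
    refine h.mono (hV.aestronglyMeasurable.inner
      (continuous_gradient hφ).aestronglyMeasurable) (.of_forall fun x => ?_)
    refine (norm_inner_le_norm _ _).trans_eq ?_
    rw [norm_gradient_eq, smul_eq_mul, norm_mul, norm_norm, norm_norm, mul_comm]
  have hpt : ∀ᵐ x, (inner ℝ (V x) (gradient (fun y => u y ^ γ * η y ^ N) x) : ℝ) ≤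
      -(-γ * am / 2) * (u x ^ (γ - 1) * ‖gradient u x‖ ^ p x * η x ^ N) +
        (ball (0 : Euc n) (2 * r)).indicator
          (fun _ => N * bP * (ε⁻¹ ^ pP * M' ^ pP) * d ^ q) x := by
    filter_upwards [hann, hp.ae_ub] with x hx hxP
    rw [inner_gradient_rpow_mul_pow γ N (hu.differentiable one_ne_zero x)
      (hη1.differentiable one_ne_zero x) (hpos x).ne']
    have hux := hpos x
    have hηx := hη.nonneg x
    have hw : 0 ≤ u x ^ (γ - 1) * η x ^ N := by positivity
    have hG : 0 ≤ u x ^ (γ - 1) * ‖gradient u x‖ ^ p x * η x ^ N := by positivity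
    have hfirst : γ * (u x ^ (γ - 1) * η x ^ N) * inner ℝ (V x) (gradient u x) ≤
        γ * am * (u x ^ (γ - 1) * ‖gradient u x‖ ^ p x * η x ^ N) := by
      have h := mul_le_mul_of_nonpos_left (mul_le_mul_of_nonneg_left (hlow x) hw) hγ.le
      linarith
    have hK : 0 ≤ N * bP * (ε⁻¹ ^ pP * M' ^ pP) * d ^ q := by positivity
    by_cases hxa : x ∈ ball (0 : Euc n) (2 * r) \ ball 0 r
    · rw [Set.indicator_of_mem hxa.1]
      have hyoung := rpow_mul_le_small_add (t := ‖gradient u x‖) (N := N) hux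
        ((huM x).trans (le_max_left M 1)) hM'1 (norm_nonneg _) hηx (hη.le_one x)
        (norm_nonneg _) (hη.fderiv_le x) hd hγ hq (hx hxa) hxP hNP hε0 hε1
      have hsecond : N * (u x ^ γ * η x ^ (N - 1)) * fderiv ℝ η x (V x) ≤
          N * bP * (u x ^ γ * η x ^ (N - 1) * ‖gradient u x‖ ^ (p x - 1) * ‖fderiv ℝ η x‖) := by
        calc N * (u x ^ γ * η x ^ (N - 1)) * fderiv ℝ η x (V x)
            ≤ N * (u x ^ γ * η x ^ (N - 1)) *
              (‖fderiv ℝ η x‖ * (bP * ‖gradient u x‖ ^ (p x - 1))) := by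
              gcongr
              exact (Real.le_norm_self _).trans ((ContinuousLinearMap.le_opNorm _ _).trans
                (mul_le_mul_of_nonneg_left (hup x) (norm_nonneg _)))
          _ = _ := by ring
      have h1 := mul_le_mul_of_nonneg_left hyoung (mul_pos hN0 hb).le
      have h2 := mul_le_mul_of_nonneg_right hεc hG
      linarith
    · have hzero : N * (u x ^ γ * η x ^ (N - 1)) * fderiv ℝ η x (V x) = 0 := by
        by_cases hx2 : x ∈ ball (0 : Euc n) (2 * r)
        · have hx1 : x ∈ ball (0 : Euc n) r := by
            by_contra h
            exact hxa ⟨hx2, h⟩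
          simp [hη.fderiv_eq_zero x hx1]
        · simp [hη.eq_zero x hx2, zero_pow (show N - 1 ≠ 0 by omega)]
      have hind : 0 ≤ (ball (0 : Euc n) (2 * r)).indicator
          (fun _ => N * bP * (ε⁻¹ ^ pP * M' ^ pP) * d ^ q) x :=
        Set.indicator_nonneg (fun _ _ => hK) x
      have h := mul_nonneg hc.le hG
      linarith
  have hindint : Integrable ((ball (0 : Euc n) (2 * r)).indicator
      (fun _ => N * bP * (ε⁻¹ ^ pP * M' ^ pP) * d ^ q)) volume :=
    (integrable_indicator_iff measurableSet_ball).2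
      (integrableOn_const (measure_ball_lt_top).ne)
  have hmono := integral_mono_ae hintV ((hint.const_mul (-(-γ * am / 2))).add hindint) hpt
  simp only [Pi.add_apply] at hmono
  rw [integral_add (hint.const_mul _) hindint, integral_const_mul,
    integral_indicator measurableSet_ball, setIntegral_const, smul_eq_mul, htest] at hmono
  rw [hrhs]
  linarith

/-- Theorem 4.3: suppose `ess inf p ≥ n + δ + 1 − γ` on annuli `B_{2R_k}∖B_{R_k}` with
`R_k → ∞`, where `δ > 0` and `γ < 0`. If `u > 0` is a bounded `(𝒜,ℬ)`-harmonic function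
with `ℬ(·,u,∇u)u^γ ∈ L¹(ℝⁿ)` and `∫_{B_R} ℬ(x,u,∇u)u^γ → 0` as `R → ∞`,
then `u` is constant. -/
theorem liouville_AB_harmonic {n : ℕ} (p : Euc n → ℝ) (pm pP : ℝ)
    (hp : IsVarExp p pm pP)
    (𝒜 : Euc n → ℝ → Euc n → Euc n) (am bP : ℝ)
    (h𝒜 : IsNSGrowth p 𝒜 am bP)
    (ℬ : Euc n → ℝ → Euc n → ℝ) (hℬ : IsAdmissibleRHS p ℬ)
    (δ γ : ℝ) (hδ : 0 < δ) (hγ : γ < 0)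
    (R : ℕ → ℝ) (hRmono : StrictMono R)
    (hRtop : Filter.Tendsto R Filter.atTop Filter.atTop)
    (hann : ∀ k, (n : ℝ) + δ + 1 - γ ≤
      essInf p (volume.restrict (Metric.ball (0 : Euc n) (2 * R k) \ Metric.ball 0 (R k))))
    (u : Euc n → ℝ) (hu : IsABHarmonic p 𝒜 ℬ u)
    (hpos : ∀ x, 0 < u x) (M : ℝ) (hbdd : ∀ x, |u x| ≤ M)
    (hL1 : Integrable (fun x => ℬ x (u x) (gradient u x) * u x ^ γ)
      (volume : Measure (Euc n)))
    (hlim : Filter.Tendsto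
      (fun R : ℝ => ∫ x in Metric.ball (0 : Euc n) R,
        ℬ x (u x) (gradient u x) * u x ^ γ)
      Filter.atTop (nhds 0)) :
    ∃ c : ℝ, ∀ x, u x = c := by
  obtain ⟨hu1, hloc, hweak⟩ := hu
  obtain ⟨a, b, -, -, hab, hlow, hup⟩ := h𝒜.growth
  obtain ⟨c₀, -, ⟨cP, hcP⟩, hB⟩ := hℬ.bound
  have hbP : 0 < bP := h𝒜.am_pos.trans_le ((hab 0).1.trans ((hab 0).2.1.trans (hab 0).2.2))
  have hgrad := continuous_gradient hu1
  have hlow' : ∀ x, am * ‖gradient u x‖ ^ p x ≤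
      (inner ℝ (𝒜 x (u x) (gradient u x)) (gradient u x) : ℝ) := fun x =>
    (mul_le_mul_of_nonneg_right (hab x).1 (by positivity)).trans (hlow x _ _)
  have hup' : ∀ x, ‖𝒜 x (u x) (gradient u x)‖ ≤ bP * ‖gradient u x‖ ^ (p x - 1) := fun x =>
    (hup x _ _).trans (mul_le_mul_of_nonneg_right (hab x).2.2 (by positivity))
  have hV : LocallyIntegrable (fun x => 𝒜 x (u x) (gradient u x)) volume :=
    locallyIntegrable_of_norm_le_rpow hp hgrad
      (measurable_caratheodory_comp h𝒜.meas h𝒜.cont hu1.continuous.measurable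
        hgrad.measurable).aestronglyMeasurable
      (fun x => (hup' x).trans (mul_le_mul_of_nonneg_left (by linarith) hbP.le))
  have hf : LocallyIntegrable (fun x => ℬ x (u x) (gradient u x)) volume :=
    locallyIntegrable_of_norm_le_rpow hp hgrad
      (measurable_caratheodory_comp hℬ.meas hℬ.cont hu1.continuous.measurable
        hgrad.measurable).aestronglyMeasurable
      (fun x => (hB x _ _).trans (mul_le_mul_of_nonneg_right (hcP x) (by positivity)))
  have hn : (0 : ℝ) ≤ n := Nat.cast_nonneg n
  obtain ⟨N, c, K, hc, henergy⟩ := energy_estimate (q := n + δ + 1 - γ) (M := M) hp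
    h𝒜.am_pos hbP hγ (by linarith) hu1 hpos (fun x => (le_abs_self _).trans (hbdd x)) hloc hV hf
    hweak hlow' hup'
  obtain ⟨C, hC, hcut⟩ := exists_cutoff n
  obtain ⟨k₀, hk₀⟩ := Filter.eventually_atTop.1 (hRtop.eventually_ge_atTop (max 1 C))
  set r : ℕ → ℝ := fun k => R (k + k₀)
  have hr1 : ∀ k, 1 ≤ r k := fun k => (le_max_left _ _).trans (hk₀ _ (Nat.le_add_left _ _))
  have hr0 : ∀ k, 0 < r k := fun k => one_pos.trans_le (hr1 k)
  have hrC : ∀ k, C / r k ≤ 1 := fun k =>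
    (div_le_one (hr0 k)).2 ((le_max_right _ _).trans (hk₀ _ (Nat.le_add_left _ _)))
  have hrtop : Filter.Tendsto r Filter.atTop Filter.atTop :=
    hRtop.comp (Filter.tendsto_add_atTop_nat k₀)
  choose ζ hζ using fun k => hcut (r k) (hr0 k)
  have hexp : ∀ k, ∀ᵐ x, x ∈ ball (0 : Euc n) (2 * r k) \ ball 0 (r k) →
      (n : ℝ) + δ + 1 - γ ≤ p x := fun k => by
    rw [← ae_restrict_iff' (measurableSet_ball.diff measurableSet_ball)]
    have hbd : Filter.IsBoundedUnder (· ≥ ·)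
        (ae (volume.restrict (ball (0 : Euc n) (2 * r k) \ ball 0 (r k)))) p :=
      ⟨pm, Filter.eventually_map.2 (ae_restrict_of_ae hp.ae_lb)⟩
    filter_upwards [ae_essInf_le hbd] with x hx
    exact (hann (k + k₀)).trans hx
  have hJ : Filter.Tendsto
      (fun k => ∫ x, ℬ x (u x) (gradient u x) * u x ^ γ * ζ k x ^ N) Filter.atTop (nhds 0) := by
    rw [← tendsto_nhds_unique
      ((aecover_ball (x := (0 : Euc n)) Filter.tendsto_id).integral_tendsto_of_countably_generated
        hL1) hlim]
    refine tendsto_integral_of_dominated_convergence _ (fun k => hL1.aestronglyMeasurable.mul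
      ((hζ k).smooth.continuous.pow N).aestronglyMeasurable) hL1.norm
      (fun k => .of_forall fun x => ?_) (.of_forall fun x => ?_)
    · rw [norm_mul, norm_pow, Real.norm_of_nonneg ((hζ k).nonneg x)]
      exact mul_le_of_le_one_right (norm_nonneg _)
        (pow_le_one₀ ((hζ k).nonneg x) ((hζ k).le_one x))
    · refine tendsto_const_nhds.congr' ?_
      filter_upwards [hrtop.eventually_gt_atTop ‖x‖] with k hk
      rw [(hζ k).eq_one x (mem_ball_zero_iff.2 hk), one_pow, mul_one]
  have hI : Filter.Tendsto (fun k => K * (C / r k) ^ ((n : ℝ) + δ + 1 - γ) *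
      volume.real (ball (0 : Euc n) (2 * r k))) Filter.atTop (nhds 0) := by
    have h := ((tendsto_rpow_neg_atTop (show 0 < δ + 1 - γ by linarith)).comp hrtop).const_mul
      (K * C ^ ((n : ℝ) + δ + 1 - γ) * 2 ^ n * volume.real (ball (0 : Euc n) 1))
    rw [mul_zero] at h
    refine h.congr fun k => ?_
    have hvol : volume.real (ball (0 : Euc n) (2 * r k)) =
        (2 * r k) ^ n * volume.real (ball (0 : Euc n) 1) := by
      rw [Measure.real, Measure.addHaar_ball_of_pos _ _ (mul_pos two_pos (hr0 k)),
        ENNReal.toReal_mul, ENNReal.toReal_ofReal (pow_nonneg (mul_pos two_pos (hr0 k)).le _),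
        finrank_euclideanSpace_fin, Measure.real]
    have hpow : r k ^ (-(δ + 1 - γ)) = r k ^ n / r k ^ ((n : ℝ) + δ + 1 - γ) := by
      rw [← Real.rpow_natCast, ← Real.rpow_sub (hr0 k)]
      congr 1
      ring
    rw [Function.comp_apply, hpow, hvol, Real.div_rpow hC.le (hr0 k).le, mul_pow]
    ring
  have hGnonneg : ∀ x, 0 ≤ u x ^ (γ - 1) * ‖gradient u x‖ ^ p x := fun x =>
    mul_nonneg (Real.rpow_nonneg (hpos x).le _) (by positivity)
  have hGzero : ∀ᵐ x, u x ^ (γ - 1) * ‖gradient u x‖ ^ p x = 0 := by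
    have hball : ∀ m : ℕ, ∀ᵐ x, x ∈ ball (0 : Euc n) m →
        u x ^ (γ - 1) * ‖gradient u x‖ ^ p x = 0 := fun m => by
      rw [← ae_restrict_iff' measurableSet_ball]
      have hone : ∀ᶠ k in Filter.atTop, ∀ x ∈ ball (0 : Euc n) m,
          u x ^ (γ - 1) * ‖gradient u x‖ ^ p x * ζ k x ^ N =
            u x ^ (γ - 1) * ‖gradient u x‖ ^ p x := by
        filter_upwards [hrtop.eventually_ge_atTop (m : ℝ)] with k hk x hx
        rw [(hζ k).eq_one x (ball_subset_ball hk hx), one_pow, mul_one]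
      have hle : ∀ᶠ k in Filter.atTop,
          c * ∫ x in ball (0 : Euc n) m, u x ^ (γ - 1) * ‖gradient u x‖ ^ p x ≤
          K * (C / r k) ^ ((n : ℝ) + δ + 1 - γ) * volume.real (ball (0 : Euc n) (2 * r k)) -
            ∫ x, ℬ x (u x) (gradient u x) * u x ^ γ * ζ k x ^ N := by
        filter_upwards [hone] with k hk
        obtain ⟨hint, hest⟩ := henergy (ζ k) (r k) _ (hζ k) (hrC k) (hexp k)
        refine le_trans (mul_le_mul_of_nonneg_left ?_ hc.le) hest
        rw [← setIntegral_congr_fun measurableSet_ball hk]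
        exact setIntegral_le_integral hint
          (.of_forall fun x => mul_nonneg (hGnonneg x) (pow_nonneg ((hζ k).nonneg x) _))
      have hle0 : ∫ x in ball (0 : Euc n) m, u x ^ (γ - 1) * ‖gradient u x‖ ^ p x ≤ 0 := by
        have h := ge_of_tendsto (hI.sub hJ) hle
        rw [sub_zero] at h
        exact nonpos_of_mul_nonpos_right h hc
      obtain ⟨k, hk⟩ := hone.exists
      have hint := (henergy (ζ k) (r k) _ (hζ k) (hrC k) (hexp k)).1.integrableOn
        (s := ball (0 : Euc n) m)
      exact (setIntegral_eq_zero_iff_of_nonneg_ae (.of_forall hGnonneg)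
        (hint.congr_fun hk measurableSet_ball)).1
        (le_antisymm hle0 (integral_nonneg hGnonneg))
    filter_upwards [ae_all_iff.2 hball] with x hx
    obtain ⟨m, hm⟩ := exists_nat_gt ‖x‖
    exact hx m (mem_ball_zero_iff.2 hm)
  have hgrad0 : gradient u = fun _ => 0 := by
    refine (hgrad.ae_eq_iff_eq volume continuous_const).1 ?_
    filter_upwards [hGzero, hp.ae_lb] with x hx hpx
    have h := (mul_eq_zero.1 hx).resolve_left (Real.rpow_pos_of_pos (hpos x) _).ne'
    exact norm_eq_zero.1 ((Real.rpow_eq_zero (norm_nonneg _)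
      (by linarith [hp.one_lt] : p x ≠ 0)).1 h)
  refine ⟨u 0, fun x => is_const_of_fderiv_eq_zero (𝕜 := ℝ) (hu1.differentiable one_ne_zero)
    (fun y => ?_) x 0⟩
  rw [← norm_eq_zero, ← norm_gradient_eq, hgrad0, norm_zero]

end
end

section
/- Let 𝒜 be of nonstandard p(·)-growth with constants a₋, b⁺, and assume 𝒜(x,t,0) = 0 for all (x,t). Suppose there exist δ > 0, γ > 0, and an increasing sequence of radii R_k → ∞ such that ess inf_{B_{2R_k}∖B_{R_k}} p ≥ n + δ + 1 + γ for every k. Let c : ℝⁿ → ℝ be a bounded measurable function with c ∈ L¹(ℝⁿ), ∫_{ℝⁿ} c(x) dx = 0, and c not equal to 0 almost everywhere. Then there exists no bounded C¹ function u : ℝⁿ → ℝ with u > 0 and x ↦ |∇u(x)|^{p(x)} locally integrable satisfying ∫_{ℝⁿ} ⟨𝒜(x,u(x),∇u(x)), ∇φ(x)⟩ dx = ∫_{ℝⁿ} c(x) u(x)^{γ} φ(x) dx for every smooth compactly supported φ : ℝⁿ → ℝ. -/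
open MeasureTheory Metric Real
open scoped ContDiff

noncomputable section

open Filter Topology ContinuousLinearMap in
/-- A `C¹` function with compact support is a `C¹`-uniform limit of smooth functions supported in a
fixed compact set. -/
lemma exists_contDiff_infty_approx {n : ℕ} {φ : Euc n → ℝ} (hφ : ContDiff ℝ 1 φ)
    (hsupp : HasCompactSupport φ) {ε : ℝ} (hε : 0 < ε) :
    ∃ ψ : Euc n → ℝ, ContDiff ℝ ∞ ψ ∧
      (∀ x ∉ cthickening 1 (tsupport φ), ψ x = 0 ∧ fderiv ℝ ψ x = 0) ∧
      (∀ x, |ψ x - φ x| ≤ ε) ∧ ∀ x, ‖fderiv ℝ ψ x - fderiv ℝ φ x‖ ≤ ε := by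
  have hφ' : Continuous (fderiv ℝ φ) := hφ.continuous_fderiv one_ne_zero
  have huc := hsupp.uniformContinuous_of_continuous hφ.continuous
  have huc' := (hsupp.fderiv ℝ).uniformContinuous_of_continuous hφ'
  obtain ⟨r₁, hr₁, h₁⟩ := Metric.uniformContinuous_iff.1 huc ε hε
  obtain ⟨r₂, hr₂, h₂⟩ := Metric.uniformContinuous_iff.1 huc' ε hε
  have hr : 0 < min 1 (min r₁ r₂) := by positivity
  let b : ContDiffBump (0 : Euc n) := ⟨min 1 (min r₁ r₂) / 2, min 1 (min r₁ r₂), by positivity,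
    by linarith⟩
  have hb : b.rOut = min 1 (min r₁ r₂) := rfl
  have hderiv (x : Euc n) : fderiv ℝ (convolution (b.normed volume) φ (lsmul ℝ ℝ) volume) x =
      convolution (b.normed volume) (fderiv ℝ φ) (lsmul ℝ ℝ) volume x := by
    rw [(hsupp.hasFDerivAt_convolution_right (lsmul ℝ ℝ)
      b.continuous_normed.locallyIntegrable hφ x).fderiv]
    rfl
  have hout (x : Euc n) (hx : x ∉ cthickening 1 (tsupport φ)) (y : Euc n)
      (hy : y ∈ ball x b.rOut) : y ∉ tsupport φ := by
    intro hmem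
    apply hx
    refine mem_cthickening_of_dist_le x y 1 _ hmem ?_
    rw [dist_comm]
    exact (mem_ball.1 hy).le.trans (hb ▸ min_le_left _ _)
  refine ⟨convolution (b.normed volume) φ (lsmul ℝ ℝ) volume,
    b.hasCompactSupport_normed.contDiff_convolution_left _ b.contDiff_normed
      hφ.continuous.locallyIntegrable, fun x hx ↦ ⟨?_, ?_⟩, fun x ↦ ?_, fun x ↦ ?_⟩
  · have hx0 := image_eq_zero_of_notMem_tsupport (hout x hx x (mem_ball_self b.rOut_pos))
    have := b.dist_normed_convolution_le (μ := volume) (x₀ := x) (ε := 0)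
      hφ.continuous.aestronglyMeasurable fun y hy ↦ by
        rw [hx0, image_eq_zero_of_notMem_tsupport (hout x hx y hy), dist_self]
    rwa [hx0, dist_le_zero] at this
  · have hz (y : Euc n) (hy : y ∈ ball x b.rOut) : fderiv ℝ φ y = 0 := by
      by_contra hne
      exact hout x hx y hy (support_fderiv_subset ℝ hne)
    have hx0 := hz x (mem_ball_self b.rOut_pos)
    have := b.dist_normed_convolution_le (μ := volume) (x₀ := x) (ε := 0)
      hφ'.aestronglyMeasurable fun y hy ↦ by rw [hx0, hz y hy, dist_self]
    rw [hx0, dist_le_zero] at this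
    rw [hderiv, this]
  · rw [← Real.dist_eq]
    refine b.dist_normed_convolution_le hφ.continuous.aestronglyMeasurable fun y hy ↦ (h₁ ?_).le
    exact (mem_ball.1 hy).trans_le (hb ▸ (min_le_right _ _).trans (min_le_left _ _))
  · rw [hderiv, ← dist_eq_norm]
    refine b.dist_normed_convolution_le hφ'.aestronglyMeasurable fun y hy ↦ (h₂ ?_).le
    exact (mem_ball.1 hy).trans_le (hb ▸ (min_le_right _ _).trans (min_le_right _ _))

open Filter Topology in
/-- A divergence-form identity tested against smooth functions also holds for `C¹` test
functions. -/
lemma integral_inner_gradient_eq_of_contDiff_one {n : ℕ} {F : Euc n → Euc n} {g : Euc n → ℝ}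
    (hF : LocallyIntegrable F) (hg : LocallyIntegrable g)
    (h : ∀ φ : Euc n → ℝ, ContDiff ℝ ∞ φ → HasCompactSupport φ →
      ∫ x, (inner ℝ (F x) (gradient φ x) : ℝ) = ∫ x, g x * φ x)
    {φ : Euc n → ℝ} (hφ : ContDiff ℝ 1 φ) (hsupp : HasCompactSupport φ) :
    ∫ x, (inner ℝ (F x) (gradient φ x) : ℝ) = ∫ x, g x * φ x := by
  simp only [inner_gradient_right, conj_trivial] at h ⊢
  set K := cthickening 1 (tsupport φ)
  have hK : IsCompact K := hsupp.isCompact.cthickening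
  choose ψ hψ hψ0 hψφ hψφ' using fun k : ℕ ↦
    exists_contDiff_infty_approx hφ hsupp (ε := 1 / ((k : ℝ) + 1)) (by positivity)
  have hle (k : ℕ) : 1 / ((k : ℝ) + 1) ≤ 1 := by
    rw [div_le_one (by positivity)]; linarith [(k.cast_nonneg : (0 : ℝ) ≤ k)]
  have hφ' : Continuous (fderiv ℝ φ) := hφ.continuous_fderiv one_ne_zero
  have hlim : Tendsto (fun k : ℕ ↦ 1 / ((k : ℝ) + 1)) atTop (𝓝 0) :=
    tendsto_one_div_add_atTop_nhds_zero_nat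
  have hFm := hF.aestronglyMeasurable
  have hgm := hg.aestronglyMeasurable
  have hL : Tendsto (fun k ↦ ∫ x, fderiv ℝ (ψ k) x (F x)) atTop
      (𝓝 (∫ x, fderiv ℝ φ x (F x))) := by
    refine tendsto_integral_of_dominated_convergence
      (K.indicator fun x ↦ ‖F x‖ * (‖fderiv ℝ φ x‖ + 1)) (fun k ↦ ?_) ?_ (fun k ↦ ?_) ?_
    · have := ((hψ k).continuous_fderiv (by simp)).aestronglyMeasurable (μ := volume)
      exact isBoundedBilinearMap_apply.continuous.comp_aestronglyMeasurable (this.prodMk hFm)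
    · rw [integrable_indicator_iff hK.measurableSet]
      exact IntegrableOn.mul_continuousOn (hF.integrableOn_isCompact hK).norm
        (hφ'.norm.add continuous_const).continuousOn hK
    · refine Eventually.of_forall fun x ↦ ?_
      by_cases hx : x ∈ K
      · rw [Set.indicator_of_mem hx, mul_comm]
        refine (ContinuousLinearMap.le_opNorm _ _).trans ?_
        gcongr
        have := norm_le_norm_add_norm_sub' (fderiv ℝ (ψ k) x) (fderiv ℝ φ x)
        linarith [hψφ' k x, hle k]
      · simp [Set.indicator_of_notMem hx, (hψ0 k x hx).2]
    · refine Eventually.of_forall fun x ↦ ?_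
      have : Tendsto (fun k ↦ fderiv ℝ (ψ k) x) atTop (𝓝 (fderiv ℝ φ x)) :=
        tendsto_iff_norm_sub_tendsto_zero.2
          (squeeze_zero (fun _ ↦ norm_nonneg _) (fun k ↦ hψφ' k x) hlim)
      exact ((ContinuousLinearMap.apply ℝ ℝ (F x)).continuous.tendsto _).comp this
  have hR : Tendsto (fun k ↦ ∫ x, g x * ψ k x) atTop (𝓝 (∫ x, g x * φ x)) := by
    refine tendsto_integral_of_dominated_convergence
      (K.indicator fun x ↦ ‖g x‖ * (‖φ x‖ + 1)) (fun k ↦ ?_) ?_ (fun k ↦ ?_) ?_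
    · exact hgm.mul (hψ k).continuous.aestronglyMeasurable
    · rw [integrable_indicator_iff hK.measurableSet]
      exact IntegrableOn.mul_continuousOn (hg.integrableOn_isCompact hK).norm
        (hφ.continuous.norm.add continuous_const).continuousOn hK
    · refine Eventually.of_forall fun x ↦ ?_
      by_cases hx : x ∈ K
      · rw [Set.indicator_of_mem hx, norm_mul]
        gcongr
        have := norm_le_norm_add_norm_sub' (ψ k x) (φ x)
        have := hψφ k x
        rw [← Real.norm_eq_abs] at this
        linarith [hle k]
      · simp [Set.indicator_of_notMem hx, (hψ0 k x hx).1]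
    · refine Eventually.of_forall fun x ↦ Tendsto.const_mul _ ?_
      exact tendsto_iff_norm_sub_tendsto_zero.2
          (squeeze_zero (fun _ ↦ norm_nonneg _) (fun k ↦ hψφ k x) hlim)
  refine tendsto_nhds_unique hL (hR.congr fun k ↦ (h (ψ k) (hψ k) ?_).symm)
  exact HasCompactSupport.intro hK fun x hx ↦ (hψ0 k x hx).1

/-- Smooth cutoff functions between concentric balls of radii `R` and `2 * R`, with gradient of
order `1 / R`. -/
lemma exists_cutoff_s9 (n : ℕ) : ∃ L : ℝ, 0 ≤ L ∧ ∀ R : ℝ, 0 < R → ∃ ζ : Euc n → ℝ,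
    ContDiff ℝ ∞ ζ ∧ HasCompactSupport ζ ∧ (∀ x, 0 ≤ ζ x) ∧ (∀ x, ζ x ≤ 1) ∧
    (∀ x ∈ ball 0 R, ζ x = 1) ∧ (∀ x ∉ ball 0 (2 * R), ζ x = 0) ∧
    ∀ x, ‖fderiv ℝ ζ x‖ ≤ L / R := by
  let χ : ContDiffBump (0 : Euc n) := ⟨1, 2, one_pos, one_lt_two⟩
  have hχ : ContDiff ℝ ∞ χ := χ.contDiff
  obtain ⟨L, hL⟩ := (hχ.continuous_fderiv (by simp)).bounded_above_of_compact_support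
    (χ.hasCompactSupport.fderiv ℝ)
  refine ⟨L, (norm_nonneg _).trans (hL 0), fun R hR ↦ ⟨fun x ↦ χ (R⁻¹ • x), ?_, ?_, ?_, ?_, ?_, ?_,
    ?_⟩⟩
  · exact hχ.comp (contDiff_const_smul _)
  · exact χ.hasCompactSupport.comp_homeomorph (Homeomorph.smulOfNeZero R⁻¹ (inv_ne_zero hR.ne'))
  · exact fun x ↦ χ.nonneg
  · exact fun x ↦ χ.le_one
  · intro x hx
    apply χ.one_of_mem_closedBall
    rw [mem_ball_zero_iff] at hx
    rw [mem_closedBall_zero_iff, norm_smul, norm_inv, Real.norm_of_nonneg hR.le,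
      inv_mul_le_iff₀ hR]
    change ‖x‖ ≤ R * 1
    linarith
  · intro x hx
    apply χ.zero_of_le_dist
    rw [mem_ball_zero_iff, not_lt] at hx
    rw [dist_zero_right, norm_smul, norm_inv, Real.norm_of_nonneg hR.le, le_inv_mul_iff₀ hR]
    change R * 2 ≤ ‖x‖
    linarith
  · intro x
    rw [fderiv_comp_smul, norm_smul, norm_inv, Real.norm_of_nonneg hR.le, inv_mul_eq_div]
    gcongr
    exact hL _

/-- Absorption of the cutoff term into the energy term, up to a power of `e`. -/
lemma mul_rpow_sub_one_le_energy_add {z u t p γ q M P e : ℝ} {m : ℕ} (hz0 : 0 ≤ z) (hz1 : z ≤ 1)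
    (hu : 0 < u) (huM : u ≤ M) (hM : 1 ≤ M) (ht : 0 ≤ t) (hp1 : 1 < p) (hpm : p - 1 ≤ m)
    (hγ : 0 ≤ γ) (hγq : γ + 1 ≤ q) (hqp : q ≤ p) (hpP : p ≤ P) (he0 : 0 ≤ e) (he1 : e ≤ 1) :
    e * (z ^ m * u ^ (-γ) * t ^ (p - 1)) ≤
      z ^ (m + 1) * u ^ (-γ - 1) * t ^ p + M ^ P * e ^ q := by
  have hM0 : 0 < M := by linarith
  have htp : t ^ p = t ^ (p - 1) * t := by
    conv_lhs => rw [← sub_add_cancel p 1]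
    exact Real.rpow_add_one' ht (by linarith)
  have huγ : u ^ (-γ) = u ^ (-γ - 1) * u := by
    conv_lhs => rw [← sub_add_cancel (-γ) 1]
    exact Real.rpow_add_one hu.ne' _
  rcases le_total (e * u) (z * t) with hle | hle
  · have : 0 ≤ M ^ P * e ^ q := by positivity
    have h2 : z ^ m * u ^ (-γ - 1) * t ^ (p - 1) * (e * u) ≤
        z ^ m * u ^ (-γ - 1) * t ^ (p - 1) * (z * t) := by gcongr
    rw [htp, huγ, pow_succ]
    linarith
  · have h0 : 0 ≤ z ^ (m + 1) * u ^ (-γ - 1) * t ^ p := by positivity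
    have hzm : z ^ m ≤ z ^ (p - 1) := by
      rw [← Real.rpow_natCast]
      rcases hz0.eq_or_lt with rfl | hz
      · rw [Real.zero_rpow (by linarith), Real.zero_rpow (by linarith)]
      · exact Real.rpow_le_rpow_of_exponent_ge hz hz1 hpm
    have h3 : z ^ (p - 1) * t ^ (p - 1) ≤ (e * u) ^ (p - 1) := by
      rw [← Real.mul_rpow hz0 ht]
      exact Real.rpow_le_rpow (by positivity) hle (by linarith)
    have hep : e * e ^ (p - 1) = e ^ p := by
      rw [mul_comm, ← Real.rpow_add_one' he0 (by linarith), sub_add_cancel]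
    have hup : u ^ (-γ) * u ^ (p - 1) ≤ M ^ P := by
      rw [← Real.rpow_add hu]
      calc u ^ (-γ + (p - 1)) ≤ M ^ (-γ + (p - 1)) :=
            Real.rpow_le_rpow hu.le huM (by linarith)
        _ ≤ M ^ P := Real.rpow_le_rpow_of_exponent_le hM (by linarith)
    have heq : e ^ p ≤ e ^ q := by
      rcases he0.eq_or_lt with rfl | he
      · rw [Real.zero_rpow (by linarith), Real.zero_rpow (by linarith)]
      · exact Real.rpow_le_rpow_of_exponent_ge he he1 hqp
    calc e * (z ^ m * u ^ (-γ) * t ^ (p - 1))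
        ≤ e * (z ^ (p - 1) * u ^ (-γ) * t ^ (p - 1)) := by gcongr
      _ = e * u ^ (-γ) * (z ^ (p - 1) * t ^ (p - 1)) := by ring
      _ ≤ e * u ^ (-γ) * (e * u) ^ (p - 1) := by gcongr
      _ = (u ^ (-γ) * u ^ (p - 1)) * (e * e ^ (p - 1)) := by rw [Real.mul_rpow he0 hu.le]; ring
      _ ≤ M ^ P * e ^ q := by rw [hep]; gcongr
      _ ≤ _ := by linarith

/-- Composing a Carathéodory map of `p(·)`-growth with a `C¹` function and its gradient gives a
locally integrable field. -/
lemma IsNSGrowth.locallyIntegrable_comp_gradient {n : ℕ} {p : Euc n → ℝ} {pm pP : ℝ}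
    (hp : IsVarExp p pm pP) {𝒜 : Euc n → ℝ → Euc n → Euc n} {am bP : ℝ}
    (h𝒜 : IsNSGrowth p 𝒜 am bP) {u : Euc n → ℝ} (hu : ContDiff ℝ 1 u) :
    LocallyIntegrable fun x ↦ 𝒜 x (u x) (gradient u x) := by
  have hgrad : Continuous (gradient u) :=
    (InnerProductSpace.toDual ℝ (Euc n)).symm.continuous.comp (hu.continuous_fderiv one_ne_zero)
  have hmeas : Measurable fun x ↦ 𝒜 x (u x) (gradient u x) := by
    have := measurable_uncurry_of_continuous_of_measurable
      (u := fun (tξ : ℝ × Euc n) (x : Euc n) ↦ 𝒜 x tξ.1 tξ.2) h𝒜.cont fun i ↦ h𝒜.meas _ _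
    exact this.comp ((hu.continuous.prodMk hgrad).measurable.prodMk measurable_id)
  obtain ⟨a, b, -, -, hab, -, hb⟩ := h𝒜.growth
  have hbP : 0 ≤ bP := h𝒜.am_pos.le.trans ((hab 0).1.trans ((hab 0).2.1.trans (hab 0).2.2))
  rw [locallyIntegrable_iff]
  intro K hK
  obtain ⟨M, hM⟩ := hK.exists_bound_of_continuousOn hgrad.continuousOn
  refine Measure.integrableOn_of_bounded (M := bP * max M 1 ^ (pP - 1)) hK.measure_lt_top.ne
    hmeas.aestronglyMeasurable ?_
  filter_upwards [ae_restrict_of_ae hp.ae_lb, ae_restrict_of_ae hp.ae_ub,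
    ae_restrict_mem hK.measurableSet] with x hx1 hx2 hxK
  refine (hb x _ _).trans ?_
  have h1 : ‖gradient u x‖ ^ (p x - 1) ≤ max M 1 ^ (p x - 1) :=
    Real.rpow_le_rpow (norm_nonneg _) ((hM x hxK).trans (le_max_left _ _))
      (by linarith [hp.one_lt])
  have h2 : max M 1 ^ (p x - 1) ≤ max M 1 ^ (pP - 1) :=
    Real.rpow_le_rpow_of_exponent_le (le_max_right _ _) (by linarith)
  exact mul_le_mul (hab x).2.2 (h1.trans h2) (by positivity) hbP

/-- Caccioppoli-type estimate: the weighted energy of a positive bounded solution of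
`-div 𝒜(x,u,∇u) = c u^γ` on a ball is controlled by a power of the radius and a cutoff mean
of `c`. -/
lemma IsNSGrowth.exists_energy_le {n : ℕ} {p : Euc n → ℝ} {pm pP : ℝ}
    (hp : IsVarExp p pm pP) {𝒜 : Euc n → ℝ → Euc n → Euc n} {am bP : ℝ}
    (h𝒜 : IsNSGrowth p 𝒜 am bP) {γ q M : ℝ} (hγ : 0 < γ) (hγq : γ + 1 ≤ q) (hM : 1 ≤ M)
    {c : Euc n → ℝ} (hc : LocallyIntegrable c) {u : Euc n → ℝ} (hu : ContDiff ℝ 1 u)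
    (hloc : LocallyIntegrable fun x ↦ ‖gradient u x‖ ^ p x) (hpos : ∀ x, 0 < u x)
    (huM : ∀ x, u x ≤ M)
    (heq : ∀ φ : Euc n → ℝ, ContDiff ℝ ∞ φ → HasCompactSupport φ →
      ∫ x, (inner ℝ (𝒜 x (u x) (gradient u x)) (gradient φ x) : ℝ)
        = ∫ x, c x * u x ^ γ * φ x) :
    ∃ (C D : ℝ) (η : ℝ → Euc n → ℝ),
      (∀ R, 0 < R → Continuous (η R) ∧ (∀ x, |η R x| ≤ 1) ∧ ∀ x ∈ ball 0 R, η R x = 1) ∧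
      ∀ R, 0 < R → D ≤ R →
        (∀ᵐ x, x ∈ ball (0 : Euc n) (2 * R) \ ball 0 R → q ≤ p x) →
        γ * am / 2 * ∫ x in ball 0 R, u x ^ (-γ - 1) * ‖gradient u x‖ ^ p x ≤
          C * R ^ (n - q) - ∫ x, c x * η R x := by
  have ham := h𝒜.am_pos
  obtain ⟨L, hL, hcut⟩ := exists_cutoff_s9 n
  choose! ζ hζ hζs hζ0 hζ1 hζin hζout hζd using hcut
  obtain ⟨a, b, -, -, hab, hAa, hAb⟩ := h𝒜.growth
  have hbP : 0 ≤ bP := ham.le.trans ((hab 0).1.trans ((hab 0).2.1.trans (hab 0).2.2))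
  set m : ℕ := ⌈pP⌉₊
  set θ : ℝ := γ * am / 2 with hθdef
  have hθ : 0 < θ := by positivity
  set D : ℝ := (m + 1) * bP * L / θ with hD
  have hD0 : 0 ≤ D := by positivity
  set F : Euc n → Euc n := fun x ↦ 𝒜 x (u x) (gradient u x)
  have hF : LocallyIntegrable F := h𝒜.locallyIntegrable_comp_gradient hp hu
  have hucont (r : ℝ) : Continuous fun x ↦ u x ^ r :=
    hu.continuous.rpow_const fun x ↦ Or.inl (hpos x).ne'
  set f : Euc n → ℝ := fun x ↦ u x ^ (-γ - 1) * ‖gradient u x‖ ^ p x with hfdef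
  have hf : LocallyIntegrable f := hloc.continuous_mul (hucont _)
  have hf0 (x : Euc n) : 0 ≤ f x :=
    mul_nonneg (Real.rpow_nonneg (hpos x).le _) (Real.rpow_nonneg (norm_nonneg _) _)
  refine ⟨θ * M ^ pP * D ^ q * volume.real (ball (0 : Euc n) 2), D, fun R x ↦ ζ R x ^ (m + 1),
    fun R hR ↦ ⟨(hζ R hR).continuous.pow _, fun x ↦ ?_, fun x hx ↦ by simp [hζin R hR x hx]⟩,
    fun R hR hDR hq ↦ ?_⟩
  · rw [abs_of_nonneg (pow_nonneg (hζ0 R hR x) _)]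
    exact pow_le_one₀ (hζ0 R hR x) (hζ1 R hR x)
  set z := ζ R
  set φ : Euc n → ℝ := fun x ↦ z x ^ (m + 1) * u x ^ (-γ)
  have hφ : ContDiff ℝ 1 φ :=
    (((hζ R hR).of_le (by simp)).pow _).mul (hu.rpow_const_of_ne fun x ↦ (hpos x).ne')
  have hzs : HasCompactSupport fun x ↦ z x ^ (m + 1) :=
    (hζs R hR).comp_left (g := fun t : ℝ ↦ t ^ (m + 1)) (by simp)
  have hφs : HasCompactSupport φ := hzs.mul_right
  have hweak := integral_inner_gradient_eq_of_contDiff_one hF (hc.mul_continuous (hucont γ))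
    heq hφ hφs
  have hrhs : ∫ x, c x * u x ^ γ * φ x = ∫ x, c x * z x ^ (m + 1) := by
    congr 1 with x
    have : u x ^ γ * u x ^ (-γ) = 1 := by rw [← Real.rpow_add (hpos x)]; simp
    linear_combination c x * z x ^ (m + 1) * this
  simp only [inner_gradient_right, conj_trivial] at hweak
  rw [hrhs] at hweak
  have hderiv (x v : Euc n) : fderiv ℝ φ x v =
      -γ * (z x ^ (m + 1) * u x ^ (-γ - 1)) * fderiv ℝ u x v +
        (m + 1) * (z x ^ m * u x ^ (-γ)) * fderiv ℝ z x v := by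
    have h1 : HasFDerivAt z (fderiv ℝ z x) x :=
      ((hζ R hR).differentiable (by simp) x).hasFDerivAt
    have h2 : HasFDerivAt u (fderiv ℝ u x) x := (hu.differentiable (by simp) x).hasFDerivAt
    have h3 : HasFDerivAt φ _ x :=
      (h1.pow (m + 1)).mul (h2.rpow_const (p := -γ) (Or.inl (hpos x).ne'))
    rw [h3.fderiv]
    simp
    ring
  have hzd (x : Euc n) (hx : x ∉ ball (0 : Euc n) (2 * R) \ ball 0 R) : fderiv ℝ z x = 0 := by
    by_cases hx2 : x ∈ ball (0 : Euc n) (2 * R)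
    · have hx1 : x ∈ ball (0 : Euc n) R := by_contra fun h ↦ hx ⟨hx2, h⟩
      refine IsLocalMax.fderiv_eq_zero (Filter.Eventually.of_forall fun y ↦ ?_)
      exact (hζ1 R hR y).trans_eq (hζin R hR x hx1).symm
    · refine IsLocalMin.fderiv_eq_zero (Filter.Eventually.of_forall fun y ↦ ?_)
      exact (hζout R hR x hx2).trans_le (hζ0 R hR y)
  have he0 : 0 ≤ D / R := by positivity
  have he1 : D / R ≤ 1 := (div_le_one hR).2 hDR
  set κ : ℝ := θ * (M ^ pP * (D / R) ^ q) with hκ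
  have hκ0 : 0 ≤ κ := by positivity
  have hpt : ∀ᵐ x, fderiv ℝ φ x (F x) ≤
      -θ * (z x ^ (m + 1) * f x) + (ball (0 : Euc n) (2 * R)).indicator (fun _ ↦ κ) x := by
    filter_upwards [hp.ae_lb, hp.ae_ub, hq] with x hx1 hx2 hx3
    have hz0 := hζ0 R hR x
    have hE : am * ‖gradient u x‖ ^ p x ≤ fderiv ℝ u x (F x) := by
      have := hAa x (u x) (gradient u x)
      rw [inner_gradient_right, conj_trivial] at this
      refine le_trans ?_ this
      gcongr
      exact (hab x).1
    have hE' : γ * am * (z x ^ (m + 1) * f x) ≤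
        γ * (z x ^ (m + 1) * u x ^ (-γ - 1)) * fderiv ℝ u x (F x) := by
      have hw : 0 ≤ γ * (z x ^ (m + 1) * u x ^ (-γ - 1)) :=
        mul_nonneg hγ.le (mul_nonneg (pow_nonneg hz0 _) (Real.rpow_nonneg (hpos x).le _))
      have := mul_le_mul_of_nonneg_left hE hw
      simp only [hfdef]
      linarith
    have hzf : 0 ≤ z x ^ (m + 1) * f x := mul_nonneg (pow_nonneg hz0 _) (hf0 x)
    have hγθ : γ * am = 2 * θ := by rw [hθdef]; ring
    rw [hγθ] at hE'
    rw [hderiv]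
    by_cases hx : x ∈ ball (0 : Euc n) (2 * R) \ ball 0 R
    · rw [Set.indicator_of_mem hx.1]
      have hkey := mul_rpow_sub_one_le_energy_add (z := z x) (m := m) hz0 (hζ1 R hR x) (hpos x)
        (huM x) hM (norm_nonneg (gradient u x)) (hp.one_lt.trans_le hx1)
        (by linarith [Nat.le_ceil pP]) hγ.le hγq (hx3 hx) hx2 he0 he1
      have hzF : fderiv ℝ z x (F x) ≤ L / R * (bP * ‖gradient u x‖ ^ (p x - 1)) := by
        refine (Real.le_norm_self _).trans ((ContinuousLinearMap.le_opNorm _ _).trans ?_)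
        gcongr
        · exact hζd R hR x
        · refine (hAb x _ _).trans ?_
          gcongr
          exact (hab x).2.2
      have hw : 0 ≤ (m + 1) * (z x ^ m * u x ^ (-γ)) :=
        mul_nonneg (by positivity) (mul_nonneg (pow_nonneg hz0 _) (Real.rpow_nonneg (hpos x).le _))
      have h1 := mul_le_mul_of_nonneg_left hzF hw
      have h2 := mul_le_mul_of_nonneg_left hkey hθ.le
      have hθD : θ * (D / R) = (m + 1) * bP * L / R := by rw [hD]; field_simp
      have h3 : (m + 1) * (z x ^ m * u x ^ (-γ)) * (L / R * (bP * ‖gradient u x‖ ^ (p x - 1))) =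
          θ * (D / R * (z x ^ m * u x ^ (-γ) * ‖gradient u x‖ ^ (p x - 1))) := by
        rw [← mul_assoc θ, hθD]; ring
      rw [h3] at h1
      simp only [hfdef] at hE' ⊢
      rw [hκ]
      linarith
    · have : 0 ≤ (ball (0 : Euc n) (2 * R)).indicator (fun _ ↦ κ) x :=
        Set.indicator_nonneg (fun _ _ ↦ hκ0) x
      rw [hzd x hx]
      simp only [_root_.zero_apply, mul_zero, add_zero]
      nlinarith
  have hzc : Continuous fun x ↦ z x ^ (m + 1) := (hζ R hR).continuous.pow _
  have hint1 : Integrable fun x ↦ z x ^ (m + 1) * f x :=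
    hf.integrable_smul_left_of_hasCompactSupport hzc hzs
  have hint2 : Integrable ((ball (0 : Euc n) (2 * R)).indicator fun _ ↦ κ) :=
    (integrable_indicator_iff measurableSet_ball).2
      (integrableOn_const measure_ball_lt_top.ne)
  have hφ' : Continuous (fderiv ℝ φ) := hφ.continuous_fderiv one_ne_zero
  have hint0 : Integrable fun x ↦ fderiv ℝ φ x (F x) := by
    refine (hF.integrable_smul_left_of_hasCompactSupport hφ'.norm (hφs.fderiv ℝ).norm).mono
      (isBoundedBilinearMap_apply.continuous.comp_aestronglyMeasurable
        (hφ'.aestronglyMeasurable.prodMk hF.aestronglyMeasurable))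
      (Filter.Eventually.of_forall fun x ↦ ?_)
    rw [norm_smul, norm_norm]
    exact ContinuousLinearMap.le_opNorm _ _
  have hmain := integral_mono_ae hint0 ((hint1.const_mul (-θ)).add hint2) hpt
  simp only [Pi.add_apply] at hmain
  rw [integral_add (hint1.const_mul (-θ)) hint2, integral_const_mul,
    integral_indicator measurableSet_ball, setIntegral_const, hweak, smul_eq_mul] at hmain
  have hball : ∫ x in ball 0 R, f x ≤ ∫ x, z x ^ (m + 1) * f x := by
    rw [← integral_indicator measurableSet_ball]
    refine integral_mono ?_ hint1 fun x ↦ ?_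
    · rw [integrable_indicator_iff measurableSet_ball]
      exact (hf.integrableOn_isCompact (isCompact_closedBall 0 R)).mono_set ball_subset_closedBall
    · by_cases hx : x ∈ ball (0 : Euc n) R
      · simp [Set.indicator_of_mem hx, z, hζin R hR x hx]
      · rw [Set.indicator_of_notMem hx]
        exact mul_nonneg (pow_nonneg (hζ0 R hR x) _) (hf0 x)
  have hvol : volume.real (ball (0 : Euc n) (2 * R)) * κ =
      θ * M ^ pP * D ^ q * volume.real (ball (0 : Euc n) 2) * R ^ (n - q) := by
    rw [mul_comm 2 R, measureReal_def, Measure.addHaar_ball_mul_of_pos volume 0 hR,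
      ENNReal.toReal_mul, ENNReal.toReal_ofReal (by positivity), finrank_euclideanSpace_fin,
      ← measureReal_def, hκ, Real.div_rpow hD0 hR.le, Real.rpow_sub hR, Real.rpow_natCast]
    ring
  rw [hvol] at hmain
  have := mul_le_mul_of_nonneg_left hball hθ.le
  linarith

/-- Example 4.4 (nonexistence): assume `𝒜(x,t,0) = 0`, `ess inf p ≥ n + δ + 1 + γ` on
annuli `B_{2R_k}∖B_{R_k}` with `R_k → ∞`, `δ, γ > 0`, and let `c ∈ L¹(ℝⁿ)` be bounded
measurable with `∫ c = 0` and `c ≢ 0`. Then the equation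
`−div 𝒜(x,u,∇u) = c(x) u^γ` has no positive bounded entire solution. -/
theorem nonexistence_c_u_gamma {n : ℕ} (p : Euc n → ℝ) (pm pP : ℝ)
    (hp : IsVarExp p pm pP)
    (𝒜 : Euc n → ℝ → Euc n → Euc n) (am bP : ℝ)
    (h𝒜 : IsNSGrowth p 𝒜 am bP)
    (h𝒜0 : ∀ (x : Euc n) (t : ℝ), 𝒜 x t 0 = 0)
    (δ γ : ℝ) (hδ : 0 < δ) (hγ : 0 < γ)
    (R : ℕ → ℝ) (hRmono : StrictMono R)
    (hRtop : Filter.Tendsto R Filter.atTop Filter.atTop)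
    (hann : ∀ k, (n : ℝ) + δ + 1 + γ ≤
      essInf p (volume.restrict (Metric.ball (0 : Euc n) (2 * R k) \ Metric.ball 0 (R k))))
    (c : Euc n → ℝ) (hcmeas : Measurable c) (hcbdd : ∃ M : ℝ, ∀ x, |c x| ≤ M)
    (hcint : Integrable c (volume : Measure (Euc n)))
    (hczero : ∫ x, c x = 0)
    (hcne : ¬ (∀ᵐ x ∂(volume : Measure (Euc n)), c x = 0)) :
    ¬ ∃ u : Euc n → ℝ, ContDiff ℝ 1 u ∧
        LocallyIntegrable (fun x => ‖gradient u x‖ ^ p x) (volume : Measure (Euc n)) ∧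
        (∀ x, 0 < u x) ∧ (∃ M : ℝ, ∀ x, |u x| ≤ M) ∧
        (∀ φ : Euc n → ℝ, ContDiff ℝ ∞ φ → HasCompactSupport φ →
          ∫ x, (inner ℝ (𝒜 x (u x) (gradient u x)) (gradient φ x) : ℝ)
            = ∫ x, c x * u x ^ γ * φ x) := by
  open Filter Topology in
  rintro ⟨u, hu, hloc, hpos, ⟨M, hM⟩, heq⟩
  have hnn (x : Euc n) : 0 ≤ u x ^ (-γ - 1) * ‖gradient u x‖ ^ p x :=
    mul_nonneg (Real.rpow_nonneg (hpos x).le _) (Real.rpow_nonneg (norm_nonneg _) _)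
  have hucont (r : ℝ) : Continuous fun x ↦ u x ^ r :=
    hu.continuous.rpow_const fun x ↦ Or.inl (hpos x).ne'
  have hf : LocallyIntegrable fun x ↦ u x ^ (-γ - 1) * ‖gradient u x‖ ^ p x :=
    hloc.continuous_mul (hucont _)
  have hfball (r : ℝ) :
      IntegrableOn (fun x ↦ u x ^ (-γ - 1) * ‖gradient u x‖ ^ p x) (ball 0 r) :=
    (hf.integrableOn_isCompact (isCompact_closedBall 0 r)).mono_set ball_subset_closedBall
  obtain ⟨C, D, η, hη, hest⟩ := h𝒜.exists_energy_le hp (q := n + δ + 1 + γ) (M := max M 1) hγ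
    (by linarith [(n.cast_nonneg : (0 : ℝ) ≤ n)]) (le_max_right _ _) hcint.locallyIntegrable hu
    hloc hpos (fun x ↦ (le_abs_self _).trans ((hM x).trans (le_max_left _ _))) heq
  have hRpos : ∀ᶠ k in atTop, 0 < R k := hRtop.eventually_gt_atTop 0
  have hann' (k : ℕ) : ∀ᵐ x, x ∈ ball (0 : Euc n) (2 * R k) \ ball 0 (R k) →
      n + δ + 1 + γ ≤ p x := by
    rw [← ae_restrict_iff' (measurableSet_ball.diff measurableSet_ball)]
    have hbdd : IsBoundedUnder (· ≥ ·)
        (ae (volume.restrict (ball (0 : Euc n) (2 * R k) \ ball 0 (R k)))) p :=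
      ⟨pm, eventually_map.2 (ae_restrict_of_ae hp.ae_lb)⟩
    filter_upwards [ae_essInf_le hbdd] with x hx
    exact (hann k).trans hx
  have hcη : Tendsto (fun k ↦ ∫ x, c x * η (R k) x) atTop (𝓝 0) := by
    rw [← hczero]
    refine tendsto_integral_filter_of_dominated_convergence (fun x ↦ |c x|) ?_ ?_ hcint.abs ?_
    · filter_upwards [hRpos] with k hk
      exact hcmeas.aestronglyMeasurable.mul (hη _ hk).1.aestronglyMeasurable
    · filter_upwards [hRpos] with k hk
      refine Eventually.of_forall fun x ↦ ?_
      rw [Real.norm_eq_abs, abs_mul]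
      exact mul_le_of_le_one_right (abs_nonneg _) ((hη _ hk).2.1 x)
    · refine Eventually.of_forall fun x ↦ tendsto_const_nhds.congr' ?_
      filter_upwards [hRpos, hRtop.eventually_gt_atTop ‖x‖] with k hk hxk
      rw [(hη _ hk).2.2 x (mem_ball_zero_iff.2 hxk), mul_one]
  have hpow : Tendsto (fun k ↦ R k ^ ((n : ℝ) - (n + δ + 1 + γ))) atTop (𝓝 0) := by
    have h := (tendsto_rpow_neg_atTop (y := δ + 1 + γ) (by positivity)).comp hRtop
    refine h.congr fun k ↦ ?_
    rw [Function.comp_apply]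
    congr 1
    ring
  have hlim := (hpow.const_mul C).sub hcη
  rw [mul_zero, sub_zero] at hlim
  have hzero (N : ℕ) : ∀ᵐ x, x ∈ ball (0 : Euc n) N →
      u x ^ (-γ - 1) * ‖gradient u x‖ ^ p x = 0 := by
    have hle : γ * am / 2 * ∫ x in ball 0 (N : ℝ), u x ^ (-γ - 1) * ‖gradient u x‖ ^ p x ≤ 0 := by
      refine ge_of_tendsto hlim ?_
      filter_upwards [hRpos, hRtop.eventually_ge_atTop D, hRtop.eventually_ge_atTop (N : ℝ)]
        with k hk hDk hNk
      refine le_trans ?_ (hest _ hk hDk (hann' k))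
      refine mul_le_mul_of_nonneg_left ?_ (by have := h𝒜.am_pos; positivity)
      exact setIntegral_mono_set (hfball _) (Eventually.of_forall hnn)
        (ball_subset_ball hNk).eventuallyLE
    have hθ : 0 < γ * am / 2 := by have := h𝒜.am_pos; positivity
    have hint0 := le_antisymm (nonpos_of_mul_nonpos_right hle hθ) (integral_nonneg hnn)
    rw [← ae_restrict_iff' measurableSet_ball]
    exact (integral_eq_zero_iff_of_nonneg hnn (hfball _)).1 hint0
  have hF0 : ∀ᵐ x, 𝒜 x (u x) (gradient u x) = 0 := by
    filter_upwards [ae_all_iff.2 hzero] with x hx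
    obtain ⟨N, hN⟩ := exists_nat_gt ‖x‖
    have h0 := (mul_eq_zero.1 (hx N (mem_ball_zero_iff.2 hN))).resolve_left
      (Real.rpow_pos_of_pos (hpos x) _).ne'
    rw [norm_eq_zero.1 ((Real.rpow_eq_zero_iff_of_nonneg (norm_nonneg _)).1 h0).1, h𝒜0]
  have hcu : ∀ᵐ x, c x * u x ^ γ = 0 := by
    refine ae_eq_zero_of_integral_contDiff_smul_eq_zero
      (hcint.locallyIntegrable.mul_continuous (hucont γ)) fun φ hφ hφs ↦ ?_
    simp only [smul_eq_mul, mul_comm (φ _)]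
    rw [← heq φ hφ hφs]
    refine integral_eq_zero_of_ae ?_
    filter_upwards [hF0] with x hx
    rw [hx, inner_zero_left, Pi.zero_apply]
  refine hcne ?_
  filter_upwards [hcu] with x hx
  exact (mul_eq_zero.1 hx).resolve_right (Real.rpow_pos_of_pos (hpos x) _).ne'

end
end

section
/- Let 𝒜 be of nonstandard p(·)-growth with constants a₋, b⁺ and assume p⁻ > n. Let f : ℝ → ℝ be a continuous nonnegative function for which there exists exactly one t₀ ∈ ℝ with f(t₀) = 0. If u is a bounded supersolution of div 𝒜(x,u,∇u) = f(u) in ℝⁿ, then u is constant (indeed u ≡ t₀). -/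
open MeasureTheory Metric Real
open scoped ContDiff

noncomputable section

open Filter Topology in
open scoped Convolution in
/-- A distributional inequality `∫ Dφ(V) ≤ 0` against nonnegative smooth test functions extends
to nonnegative `C¹` test functions when `V` is locally integrable. -/
theorem integral_fderiv_apply_nonpos_of_contDiff_one {E : Type*} [NormedAddCommGroup E]
    [InnerProductSpace ℝ E] [FiniteDimensional ℝ E] [MeasurableSpace E] [BorelSpace E]
    {μ : Measure E} [μ.IsAddHaarMeasure] {V : E → E} (hV : LocallyIntegrable V μ)
    (h : ∀ φ : E → ℝ, ContDiff ℝ ∞ φ → HasCompactSupport φ → (∀ x, 0 ≤ φ x) →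
      ∫ x, fderiv ℝ φ x (V x) ∂μ ≤ 0)
    {φ : E → ℝ} (hφ : ContDiff ℝ 1 φ) (hφc : HasCompactSupport φ) (hφ0 : ∀ x, 0 ≤ φ x) :
    ∫ x, fderiv ℝ φ x (V x) ∂μ ≤ 0 := by
  have hD : Continuous (fderiv ℝ φ) := hφ.continuous_fderiv one_ne_zero
  have hDc : HasCompactSupport (fderiv ℝ φ) := hφc.fderiv ℝ
  obtain ⟨B, hB⟩ := hD.bounded_above_of_compact_support hDc
  let ρ : ℕ → ContDiffBump (0 : E) := fun j =>
    ⟨1 / (j + 1) / 2, 1 / (j + 1), by positivity, half_lt_self (by positivity)⟩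
  have hρ : Tendsto (fun j => (ρ j).rOut) atTop (𝓝 0) := tendsto_one_div_add_atTop_nhds_zero_nat
  have hρ1 : ∀ j, (ρ j).rOut ≤ 1 := fun j => by
    change (1 : ℝ) / (j + 1) ≤ 1
    rw [div_le_one (by positivity)]
    linarith [(Nat.cast_nonneg j : (0 : ℝ) ≤ j)]
  let ψ : ℕ → E → ℝ := fun j => (ρ j).normed μ ⋆[ContinuousLinearMap.lsmul ℝ ℝ, μ] φ
  have hψ : ∀ j, ContDiff ℝ ∞ (ψ j) := fun j =>
    (ρ j).hasCompactSupport_normed.contDiff_convolution_left _ (ρ j).contDiff_normed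
      hφ.continuous.locallyIntegrable
  have hψc : ∀ j, HasCompactSupport (ψ j) := fun j =>
    (ρ j).hasCompactSupport_normed.convolution _ hφc
  have hψ0 : ∀ j x, 0 ≤ ψ j x := fun j x =>
    integral_nonneg fun t => mul_nonneg ((ρ j).nonneg_normed t) (hφ0 _)
  have hψD : ∀ j x, fderiv ℝ (ψ j) x =
      ((ρ j).normed μ ⋆[ContinuousLinearMap.lsmul ℝ ℝ, μ] fderiv ℝ φ) x := fun j x =>
    (hφc.hasFDerivAt_convolution_right _
      (ρ j).continuous_normed.locallyIntegrable hφ x).fderiv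
  let K : Set E := cthickening 1 (tsupport (fderiv ℝ φ))
  have hK : IsCompact K := hDc.isCompact.cthickening
  have hbound : ∀ j x, ‖fderiv ℝ (ψ j) x‖ ≤ 3 * B := fun j x => by
    have h1 : dist (fderiv ℝ (ψ j) x) (fderiv ℝ φ x) ≤ 2 * B := by
      rw [hψD]
      refine ContDiffBump.dist_normed_convolution_le hD.aestronglyMeasurable fun y _ => ?_
      linarith [dist_le_norm_add_norm (fderiv ℝ φ y) (fderiv ℝ φ x), hB x, hB y]
    rw [dist_eq_norm] at h1
    linarith [norm_le_norm_sub_add (fderiv ℝ (ψ j) x) (fderiv ℝ φ x), hB x]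
  have hzero : ∀ j, ∀ x ∉ K, fderiv ℝ (ψ j) x = 0 := fun j x hx => by
    have h0 : ∀ y ∈ ball x (ρ j).rOut, fderiv ℝ φ y = 0 := fun y hy => by
      by_contra hne
      exact hx (mem_cthickening_of_dist_le x y 1 _ (subset_tsupport _ hne)
        (((dist_comm x y).trans_lt hy).le.trans (hρ1 j)))
    have hx0 := h0 x (mem_ball_self (ρ j).rOut_pos)
    rw [hψD, ContDiffBump.normed_convolution_eq_right fun y hy => by rw [h0 y hy, hx0], hx0]
  refine le_of_tendsto (f := fun j => ∫ x, fderiv ℝ (ψ j) x (V x) ∂μ) (x := atTop) ?_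
    (Eventually.of_forall fun j => h _ (hψ j) (hψc j) (hψ0 j))
  refine tendsto_integral_of_dominated_convergence (K.indicator fun x => 3 * B * ‖V x‖)
    (fun j => ?_) ?_ (fun j => ?_) ?_
  · exact (ContinuousLinearMap.apply ℝ ℝ).flip.aestronglyMeasurable_comp₂
      (((hψ j).continuous_fderiv (by simp)).aestronglyMeasurable) hV.aestronglyMeasurable
  · rw [integrable_indicator_iff hK.measurableSet]
    exact ((hV.integrableOn_isCompact hK).norm).const_mul _
  · refine Eventually.of_forall fun x => ?_
    by_cases hx : x ∈ K
    · rw [Set.indicator_of_mem hx]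
      exact (ContinuousLinearMap.le_opNorm _ _).trans
        (mul_le_mul_of_nonneg_right (hbound j x) (norm_nonneg _))
    · simp [Set.indicator_of_notMem hx, hzero j x hx]
  · refine Eventually.of_forall fun x => ?_
    have := ContDiffBump.convolution_tendsto_right_of_continuous (μ := μ) hρ hD x
    simp_rw [← hψD] at this
    exact ((ContinuousLinearMap.apply ℝ ℝ (V x)).continuous.tendsto _).comp this

/-- Smooth cutoffs between concentric balls of radii `R` and `2R` with gradient `O(1/R)`. -/
theorem exists_contDiff_cutoff (E : Type*) [NormedAddCommGroup E]
    [InnerProductSpace ℝ E] [FiniteDimensional ℝ E] :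
    ∃ D : ℝ, 0 < D ∧ ∀ R : ℝ, 0 < R → ∃ η : E → ℝ, ContDiff ℝ ∞ η ∧
      (∀ x, 0 ≤ η x) ∧ (∀ x, η x ≤ 1) ∧ (∀ x ∈ closedBall (0 : E) R, η x = 1) ∧
      tsupport η ⊆ closedBall 0 (2 * R) ∧ ∀ x, ‖fderiv ℝ η x‖ ≤ D / R := by
  let χ : ContDiffBump (0 : E) := ⟨1, 2, one_pos, one_lt_two⟩
  obtain ⟨D, hD⟩ := ((χ.contDiff (n := 1)).continuous_fderiv
    one_ne_zero).bounded_above_of_compact_support (χ.hasCompactSupport.fderiv ℝ)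
  have hD0 : 0 ≤ D := (norm_nonneg _).trans (hD 0)
  refine ⟨D + 1, by linarith, fun R hR => ⟨fun x => χ (R⁻¹ • x), χ.contDiff.comp
    (contDiff_const_smul _), fun x => χ.nonneg, fun x => χ.le_one, fun x hx => ?_, ?_,
    fun x => ?_⟩⟩
  · refine χ.one_of_mem_closedBall ?_
    rw [mem_closedBall_zero_iff] at hx ⊢
    rw [norm_smul, norm_inv, norm_of_nonneg hR.le, inv_mul_le_iff₀ hR]
    simpa [χ] using hx
  · refine closure_minimal (fun x hx => ?_) isClosed_closedBall
    have hx' : R⁻¹ • x ∈ Function.support χ := hx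
    rw [χ.support_eq, mem_ball_zero_iff, norm_smul, norm_inv, norm_of_nonneg hR.le,
      inv_mul_lt_iff₀ hR] at hx'
    rw [mem_closedBall_zero_iff, mul_comm]
    exact hx'.le
  · rw [fderiv_comp_smul, norm_smul, norm_inv, norm_of_nonneg hR.le, div_eq_inv_mul]
    gcongr
    linarith [hD (R⁻¹ • x)]

/-- Young-type absorption with constants uniform in the exponent `q ∈ (1, Q]`. -/
theorem mul_rpow_sub_one_mul_pow_le {A C a s d q Q : ℝ} {k : ℕ} (hA : 0 < A) (hC : 0 ≤ C)
    (ha : 0 ≤ a) (hs : 0 ≤ s) (hs1 : s ≤ 1) (hd : 0 ≤ d) (hq : 1 < q) (hqQ : q ≤ Q)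
    (hQk : Q ≤ k + 1) :
    C * (a ^ (q - 1) * s ^ k * d) ≤
      A * (a ^ q * s ^ (k + 1)) + C * (1 + C / A) ^ (Q - 1) * d ^ q := by
  have split : ∀ {y : ℝ}, 0 ≤ y → y ^ q = y ^ (q - 1) * y := fun {y} hy => by
    conv_lhs => rw [← sub_add_cancel q 1]
    rw [rpow_add_of_nonneg hy (by linarith) zero_le_one, rpow_one]
  have hc : 0 ≤ C / A := by positivity
  rcases le_or_gt (C * d) (A * (a * s)) with h | h
  · have h1 : a ^ (q - 1) * s ^ k * (C * d) ≤ a ^ (q - 1) * s ^ k * (A * (a * s)) :=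
      mul_le_mul_of_nonneg_left h (by positivity)
    have h2 : 0 ≤ C * (1 + C / A) ^ (Q - 1) * d ^ q := by positivity
    rw [split ha, pow_succ]
    linarith
  · have h1 : a * s ≤ C / A * d := by
      rw [div_mul_eq_mul_div, le_div_iff₀ hA]
      linarith
    have h2 : s ^ k ≤ s ^ (q - 1) := by
      rw [← rpow_natCast]
      exact rpow_le_rpow_of_exponent_ge_of_imp hs hs1 (by linarith)
        (fun _ h => absurd h (by linarith))
    have h3 : a ^ (q - 1) * s ^ k ≤ (1 + C / A) ^ (Q - 1) * d ^ (q - 1) := by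
      calc a ^ (q - 1) * s ^ k ≤ a ^ (q - 1) * s ^ (q - 1) := by gcongr
        _ = (a * s) ^ (q - 1) := (mul_rpow ha hs).symm
        _ ≤ (C / A * d) ^ (q - 1) := rpow_le_rpow (by positivity) h1 (by linarith)
        _ = (C / A) ^ (q - 1) * d ^ (q - 1) := mul_rpow hc hd
        _ ≤ (1 + C / A) ^ (q - 1) * d ^ (q - 1) := by
            gcongr
            linarith
        _ ≤ (1 + C / A) ^ (Q - 1) * d ^ (q - 1) := by
            gcongr
            linarith
    have h4 : 0 ≤ A * (a ^ q * s ^ (k + 1)) := by positivity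
    have h5 := mul_le_mul_of_nonneg_left h3 (mul_nonneg hC hd)
    rw [split hd]
    linarith

theorem gradient_eq_zero_iff {E : Type*} [NormedAddCommGroup E] [InnerProductSpace ℝ E]
    [CompleteSpace E] {u : E → ℝ} {x : E} : gradient u x = 0 ↔ fderiv ℝ u x = 0 := by
  simp [gradient]

theorem ContDiff.continuous_gradient {E : Type*} [NormedAddCommGroup E] [InnerProductSpace ℝ E]
    [CompleteSpace E] {u : E → ℝ} (hu : ContDiff ℝ 1 u) : Continuous (gradient u) :=
  (InnerProductSpace.toDual ℝ E).symm.continuous.comp (hu.continuous_fderiv one_ne_zero)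

/-- The flux `x ↦ 𝒜(x, u(x), ∇u(x))` of a `C¹` function is locally integrable. -/
theorem IsNSGrowth.locallyIntegrable_flux {n : ℕ} {p : Euc n → ℝ} {pm pP : ℝ}
    (hp : IsVarExp p pm pP) {𝒜 : Euc n → ℝ → Euc n → Euc n} {am bP : ℝ}
    (h𝒜 : IsNSGrowth p 𝒜 am bP) {u : Euc n → ℝ} (hu : ContDiff ℝ 1 u) :
    LocallyIntegrable (fun x => 𝒜 x (u x) (gradient u x)) volume := by
  obtain ⟨a, b, -, -, hab, -, hgrow⟩ := h𝒜.growth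
  have hmeas : Measurable (fun x => 𝒜 x (u x) (gradient u x)) :=
    (measurable_uncurry_of_continuous_of_measurable
      (u := fun (q : ℝ × Euc n) x => 𝒜 x q.1 q.2) h𝒜.cont fun q => h𝒜.meas q.1 q.2).comp
      ((hu.continuous.measurable.prodMk hu.continuous_gradient.measurable).prodMk measurable_id)
  have hdom : LocallyIntegrable (fun x => bP * (1 + ‖gradient u x‖) ^ (pP - 1))
      (volume : Measure (Euc n)) :=
    (continuous_const.mul ((continuous_const.add hu.continuous_gradient.norm).rpow_const
      fun x => Or.inl (add_pos_of_pos_of_nonneg one_pos (norm_nonneg _)).ne')).locallyIntegrable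
  refine hdom.mono hmeas.aestronglyMeasurable ?_
  filter_upwards [hp.ae_lb, hp.ae_ub] with x hlb hub
  have h1 := hp.one_lt
  have hg := norm_nonneg (gradient u x)
  obtain ⟨ha, hb, hb'⟩ := hab x
  have hbP : 0 ≤ bP := h𝒜.am_pos.le.trans (ha.trans (hb.trans hb'))
  refine (hgrow x _ _).trans (le_trans ?_ (le_abs_self _))
  calc b x * ‖gradient u x‖ ^ (p x - 1) ≤ bP * ‖gradient u x‖ ^ (p x - 1) := by gcongr
    _ ≤ bP * (1 + ‖gradient u x‖) ^ (p x - 1) := by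
      gcongr
      · linarith
      · linarith
    _ ≤ bP * (1 + ‖gradient u x‖) ^ (pP - 1) := by
      gcongr
      linarith

/-- Pointwise Caccioppoli inequality for the test function `(u + M) η ^ (k + 1)`. -/
theorem pointwise_caccioppoli {E : Type*} [NormedAddCommGroup E] [InnerProductSpace ℝ E]
    [CompleteSpace E] {u η : E → ℝ} {x W : E} {A B M q Q : ℝ} {k : ℕ}
    (hu : DifferentiableAt ℝ u x) (hη : DifferentiableAt ℝ η x) (hA : 0 < A) (hB : 0 ≤ B)
    (huM : |u x| ≤ M) (hη0 : 0 ≤ η x) (hη1 : η x ≤ 1) (hq : 1 < q) (hqQ : q ≤ Q)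
    (hQk : Q ≤ k + 1)
    (hW : A * ‖gradient u x‖ ^ q ≤ inner ℝ W (gradient u x))
    (hW' : ‖W‖ ≤ B * ‖gradient u x‖ ^ (q - 1)) :
    A / 2 * (‖gradient u x‖ ^ q * η x ^ (k + 1)) ≤
      fderiv ℝ (fun y => (u y + M) * η y ^ (k + 1)) x W +
        (k + 1) * (2 * M) * B * (1 + (k + 1) * (2 * M) * B / (A / 2)) ^ (Q - 1) *
          ‖fderiv ℝ η x‖ ^ q := by
  obtain ⟨h1, h2⟩ := abs_le.1 huM
  have hM : 0 ≤ M := (abs_nonneg _).trans huM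
  have hyoung := mul_rpow_sub_one_mul_pow_le (A := A / 2) (C := (k + 1) * (2 * M) * B)
    (k := k) (by positivity) (by positivity) (norm_nonneg (gradient u x)) hη0 hη1
    (norm_nonneg (fderiv ℝ η x)) hq hqQ hQk
  have hD : fderiv ℝ (fun y => (u y + M) * η y ^ (k + 1)) x W =
      η x ^ (k + 1) * fderiv ℝ u x W +
        (u x + M) * ((k + 1) * η x ^ k * fderiv ℝ η x W) := by
    rw [fderiv_fun_mul (hu.add_const M) (hη.fun_pow _), fderiv_fun_pow _ hη,
      fderiv_add_const]
    simp only [add_apply, smul_apply, smul_eq_mul,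
      Nat.add_sub_cancel, nsmul_eq_mul]
    push_cast
    ring
  have hu' : inner ℝ W (gradient u x) = fderiv ℝ u x W := by
    rw [real_inner_comm, inner_gradient_left]
  have hmain : A * ‖gradient u x‖ ^ q * η x ^ (k + 1) ≤ η x ^ (k + 1) * fderiv ℝ u x W := by
    rw [mul_comm (η x ^ (k + 1)), ← hu']
    gcongr
  have hη' : |fderiv ℝ η x W| ≤ ‖fderiv ℝ η x‖ * (B * ‖gradient u x‖ ^ (q - 1)) :=
    ((fderiv ℝ η x).le_opNorm W).trans (by gcongr)
  have herr : |(u x + M) * ((k + 1) * η x ^ k * fderiv ℝ η x W)| ≤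
      (2 * M) * ((k + 1) * η x ^ k * (‖fderiv ℝ η x‖ * (B * ‖gradient u x‖ ^ (q - 1)))) := by
    rw [abs_mul, abs_mul, abs_of_nonneg (by linarith : 0 ≤ u x + M),
      abs_of_nonneg (by positivity : 0 ≤ ((k : ℝ) + 1) * η x ^ k)]
    gcongr
    linarith
  rw [hD]
  linarith [(abs_le.1 herr).1]

/-- Bounded `C¹` functions whose flux has nonnegative divergence have zero gradient when
`p⁻ > n`. -/
theorem gradient_eq_zero_of_bounded_subsolution {n : ℕ} {p : Euc n → ℝ} {pm pP : ℝ}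
    (hp : IsVarExp p pm pP) (hpn : (n : ℝ) < pm)
    {𝒜 : Euc n → ℝ → Euc n → Euc n} {am bP : ℝ} (h𝒜 : IsNSGrowth p 𝒜 am bP)
    {u : Euc n → ℝ} (hu : IsASubsolution p 𝒜 u) {M : ℝ} (hbdd : ∀ x, |u x| ≤ M) :
    ∀ x, gradient u x = 0 := by
  obtain ⟨huC, hloc, hsub⟩ := hu
  obtain ⟨a, b, -, -, hab, hell, hgrow⟩ := h𝒜.growth
  have hbP : 0 ≤ bP := h𝒜.am_pos.le.trans ((hab 0).1.trans ((hab 0).2.1.trans (hab 0).2.2))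
  have hM : 0 ≤ M := (abs_nonneg _).trans (hbdd 0)
  have ham := h𝒜.am_pos
  have hp1 := hp.one_lt
  set V : Euc n → Euc n := fun x => 𝒜 x (u x) (gradient u x) with hVdef
  have hV : LocallyIntegrable V volume := h𝒜.locallyIntegrable_flux hp huC
  have htest : ∀ φ : Euc n → ℝ, ContDiff ℝ 1 φ → HasCompactSupport φ → (∀ x, 0 ≤ φ x) →
      ∫ x, fderiv ℝ φ x (V x) ≤ 0 := fun φ hφ hφc hφ0 =>
    integral_fderiv_apply_nonpos_of_contDiff_one hV (fun ψ hψ hψc hψ0 => by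
      simpa [inner_gradient_right] using hsub ψ hψ hψc hψ0) hφ hφc hφ0
  obtain ⟨k, hk⟩ : ∃ k : ℕ, pP ≤ k + 1 :=
    ⟨⌈pP⌉₊, (Nat.le_ceil pP).trans (by linarith)⟩
  obtain ⟨D, hD, hcut⟩ := exists_contDiff_cutoff (Euc n)
  set C : ℝ := (k + 1) * (2 * M) * bP * (1 + (k + 1) * (2 * M) * bP / (am / 2)) ^ (pP - 1)
    with hCdef
  have hC : 0 ≤ C := by positivity
  have hest : ∀ R r : ℝ, 0 < R → D ≤ R → r ≤ R →
      am / 2 * ∫ x in closedBall (0 : Euc n) r, ‖gradient u x‖ ^ p x ≤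
        C * (D / R) ^ pm * volume.real (closedBall (0 : Euc n) (2 * R)) := by
    intro R r hR hDR hrR
    obtain ⟨η, hη, hη0, hη1, hηone, hηsupp, hηD⟩ := hcut R hR
    set φ : Euc n → ℝ := fun y => (u y + M) * η y ^ (k + 1) with hφdef
    have hφ : ContDiff ℝ 1 φ :=
      (huC.add contDiff_const).mul ((hη.of_le (by simp)).pow _)
    have hηc : HasCompactSupport η :=
      (isCompact_closedBall _ _).of_isClosed_subset (isClosed_tsupport _) hηsupp
    have hφc : HasCompactSupport φ :=
      hηc.mono fun x hx hx0 => hx (by simp [hφdef, hx0])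
    have hφ0 : ∀ x, 0 ≤ φ x := fun x =>
      mul_nonneg (by linarith [(abs_le.1 (hbdd x)).1]) (pow_nonneg (hη0 x) _)
    have hφint : Integrable (fun x => fderiv ℝ φ x (V x)) volume := by
      have hφD := hφ.continuous_fderiv one_ne_zero
      obtain ⟨L, hL⟩ := hφD.bounded_above_of_compact_support (hφc.fderiv ℝ)
      rw [← integrableOn_iff_integrable_of_support_subset (s := tsupport φ) fun x hx =>
        support_fderiv_subset ℝ fun h0 => hx (by simp [h0])]
      refine ((hV.integrableOn_isCompact hφc.isCompact).norm.const_mul L).mono'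
        ((ContinuousLinearMap.apply ℝ ℝ).flip.aestronglyMeasurable_comp₂
          hφD.aestronglyMeasurable hV.aestronglyMeasurable).restrict
        (Filter.Eventually.of_forall fun x => ?_)
      exact (ContinuousLinearMap.le_opNorm _ _).trans
        (mul_le_mul_of_nonneg_right (hL x) (norm_nonneg _))
    have hpt : ∀ᵐ x ∂(volume : Measure (Euc n)),
        (closedBall (0 : Euc n) r).indicator (fun x => am / 2 * ‖gradient u x‖ ^ p x) x ≤
          fderiv ℝ φ x (V x) +
            (closedBall (0 : Euc n) (2 * R)).indicator (fun _ => C * (D / R) ^ pm) x := by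
      filter_upwards [hp.ae_lb, hp.ae_ub] with x hlb hub
      have hcacc := pointwise_caccioppoli (W := V x) (A := am) (B := bP) (k := k)
        (huC.differentiable one_ne_zero x) (hη.differentiable (by simp) x) ham hbP (hbdd x)
        (hη0 x) (hη1 x) (hp1.trans_le hlb) hub hk
        (le_trans (by gcongr; exact (hab x).1) (hell x (u x) (gradient u x)))
        ((hgrow x (u x) (gradient u x)).trans
          (by gcongr; exact (hab x).2.2))
      rw [← hCdef, ← hφdef] at hcacc
      have hleft : (closedBall (0 : Euc n) r).indicator
          (fun x => am / 2 * ‖gradient u x‖ ^ p x) x ≤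
          am / 2 * (‖gradient u x‖ ^ p x * η x ^ (k + 1)) := by
        by_cases hx : x ∈ closedBall (0 : Euc n) r
        · rw [Set.indicator_of_mem hx, hηone x (closedBall_subset_closedBall hrR hx)]
          simp
        · rw [Set.indicator_of_notMem hx]
          have := hη0 x
          positivity
      have hright : C * ‖fderiv ℝ η x‖ ^ p x ≤
          (closedBall (0 : Euc n) (2 * R)).indicator (fun _ => C * (D / R) ^ pm) x := by
        by_cases hx : x ∈ closedBall (0 : Euc n) (2 * R)
        · rw [Set.indicator_of_mem hx]
          gcongr
          calc ‖fderiv ℝ η x‖ ^ p x ≤ (D / R) ^ p x :=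
                rpow_le_rpow (norm_nonneg _) (hηD x) (by linarith)
            _ ≤ (D / R) ^ pm :=
                rpow_le_rpow_of_exponent_ge (by positivity) ((div_le_one hR).2 hDR) hlb
        · have h0 : fderiv ℝ η x = 0 := by
            by_contra hne
            exact hx (hηsupp (support_fderiv_subset ℝ hne))
          rw [Set.indicator_of_notMem hx, h0, norm_zero, zero_rpow (by linarith), mul_zero]
      linarith
    have hconst : Integrable ((closedBall (0 : Euc n) (2 * R)).indicator
        fun _ => C * (D / R) ^ pm) volume := by
      rw [integrable_indicator_iff measurableSet_closedBall]
      exact (continuous_const.locallyIntegrable).integrableOn_isCompact (isCompact_closedBall _ _)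
    have hgrad : Integrable ((closedBall (0 : Euc n) r).indicator
        fun x => am / 2 * ‖gradient u x‖ ^ p x) volume := by
      rw [integrable_indicator_iff measurableSet_closedBall]
      exact (hloc.integrableOn_isCompact (isCompact_closedBall _ _)).const_mul _
    have hmono := integral_mono_ae hgrad (hφint.add hconst) hpt
    simp only [Pi.add_apply] at hmono
    rw [integral_add hφint hconst, integral_indicator measurableSet_closedBall,
      integral_indicator measurableSet_closedBall, integral_const_mul, setIntegral_const,
      smul_eq_mul] at hmono
    linarith [htest φ hφ hφc hφ0]
  have hlim : Filter.Tendsto (fun R : ℝ => C * (D / R) ^ pm *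
      volume.real (closedBall (0 : Euc n) (2 * R))) Filter.atTop (nhds 0) := by
    have hdecay : Filter.Tendsto (fun R : ℝ => C * D ^ pm * 2 ^ n *
        volume.real (ball (0 : Euc n) 1) * R ^ (-(pm - n))) Filter.atTop (nhds 0) := by
      simpa using (tendsto_rpow_neg_atTop (by linarith : 0 < pm - n)).const_mul
        (C * D ^ pm * 2 ^ n * volume.real (ball (0 : Euc n) 1))
    refine hdecay.congr' ?_
    filter_upwards [Filter.eventually_gt_atTop 0] with R hR
    rw [Measure.addHaar_real_closedBall _ _ (by positivity), finrank_euclideanSpace_fin,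
      div_rpow hD.le hR.le, neg_sub, rpow_sub hR, rpow_natCast, mul_pow]
    ring
  have hzero : ∀ r : ℝ, ∫ x in closedBall (0 : Euc n) r, ‖gradient u x‖ ^ p x = 0 := by
    intro r
    have hle : am / 2 * ∫ x in closedBall (0 : Euc n) r, ‖gradient u x‖ ^ p x ≤ 0 := by
      refine ge_of_tendsto hlim ?_
      filter_upwards [Filter.eventually_gt_atTop 0, Filter.eventually_ge_atTop D,
        Filter.eventually_ge_atTop r] with R h1 h2 h3 using hest R r h1 h2 h3
    refine le_antisymm (nonpos_of_mul_nonpos_right hle (by positivity)) ?_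
    exact integral_nonneg fun x => by positivity
  have hae : ∀ᵐ x ∂(volume : Measure (Euc n)), gradient u x = 0 := by
    have hN : ∀ N : ℕ, ∀ᵐ x ∂(volume : Measure (Euc n)),
        x ∈ closedBall (0 : Euc n) N → ‖gradient u x‖ ^ p x = 0 := fun N =>
      (ae_restrict_iff' measurableSet_closedBall).1
        ((integral_eq_zero_iff_of_nonneg (fun x => by positivity)
          (hloc.integrableOn_isCompact (isCompact_closedBall _ _))).1 (hzero N))
    filter_upwards [ae_all_iff.2 hN] with x hx
    have h0 := hx ⌈‖x‖⌉₊ (mem_closedBall_zero_iff.2 (Nat.le_ceil _))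
    exact norm_eq_zero.1 ((rpow_eq_zero_iff_of_nonneg (norm_nonneg _)).1 h0).1
  exact fun x => congrFun ((huC.continuous_gradient.ae_eq_iff_eq volume continuous_const).1 hae) x

/-- Theorem 4.7: let `p⁻ > n` and let `f` be continuous, nonnegative with exactly one
zero `t₀`. Then every bounded supersolution of `div 𝒜(x,u,∇u) = f(u)` in `ℝⁿ`
is constant (indeed `u ≡ t₀`). -/
theorem liouville_supersolution_f {n : ℕ} (p : Euc n → ℝ) (pm pP : ℝ)
    (hp : IsVarExp p pm pP) (hpn : (n : ℝ) < pm)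
    (𝒜 : Euc n → ℝ → Euc n → Euc n) (am bP : ℝ)
    (h𝒜 : IsNSGrowth p 𝒜 am bP)
    (f : ℝ → ℝ) (hfc : Continuous f) (hf0 : ∀ t, 0 ≤ f t)
    (t₀ : ℝ) (ht₀ : f t₀ = 0) (huniq : ∀ t, f t = 0 → t = t₀)
    (u : Euc n → ℝ) (hu : IsFSupersolution p 𝒜 f u)
    (M : ℝ) (hbdd : ∀ x, |u x| ≤ M) :
    ∀ x, u x = t₀ := by
  obtain ⟨huC, hloc, htest⟩ := hu
  have hgrad : ∀ x, gradient u x = 0 := by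
    refine gradient_eq_zero_of_bounded_subsolution hp hpn h𝒜
      ⟨huC, hloc, fun φ hφ hφc hφ0 => ?_⟩ hbdd
    have hpos : 0 ≤ ∫ x, f (u x) * φ x := integral_nonneg fun x => mul_nonneg (hf0 _) (hφ0 x)
    linarith [htest φ hφ hφc hφ0]
  have hconst : ∀ x, u x = u 0 := fun x =>
    is_const_of_fderiv_eq_zero (huC.differentiable one_ne_zero)
      (fun y => gradient_eq_zero_iff.1 (hgrad y)) x 0
  obtain ⟨a, b, -, -, -, -, hgrow⟩ := h𝒜.growth
  let χ : ContDiffBump (0 : Euc n) := ⟨1, 2, one_pos, one_lt_two⟩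
  have hflux : ∫ x, (inner ℝ (𝒜 x (u x) (gradient u x)) (gradient χ x) : ℝ) = 0 := by
    refine integral_eq_zero_of_ae ?_
    filter_upwards [hp.ae_lb] with x hlb
    have h1 := hp.one_lt
    have hA := hgrow x (u x) (gradient u x)
    rw [hgrad x, norm_zero, zero_rpow (by linarith), mul_zero] at hA
    simp [hgrad x, norm_le_zero_iff.1 hA]
  have hχ := htest χ χ.contDiff χ.hasCompactSupport fun x => χ.nonneg
  simp_rw [hconst] at hχ hflux
  rw [hflux, neg_zero, integral_const_mul] at hχ
  have hf : f (u 0) ≤ 0 := nonpos_of_mul_nonpos_left hχ χ.integral_pos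
  intro x
  rw [hconst x]
  exact huniq _ (le_antisymm hf (hf0 _))

end
end
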